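/- Let p be a positive integer and let γ_1 ≥ ... ≥ γ_{2p} ≥ 0 and s_1 ≥ ... ≥ s_p ≥ 0 be real numbers. Then the following are equivalent: (a) there exist p×p complex Hermitian matrices A, B, C with eigenvalues γ_1, γ_3, ..., γ_{2p−1} (of A), γ_2, γ_4, ..., γ_{2p} (of B), and s_1, ..., s_p (of C), such that 2C ≤ A + B; (b) there exist p×p complex Hermitian matrices A, B, C such that the 2p×2p block-diagonal matrix [[A,0],[0,B]] has eigenvalues γ_1, ..., γ_{2p}, C has eigenvalues s_1, ..., s_p, and 2C ≤ A + B. -/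

import Mathlib

open scoped ComplexOrder

/-- `M` is a Hermitian matrix whose eigenvalues, with multiplicity, are `{μ i : i}`. -/
def HasEigs {ι : Type} [Fintype ι] [DecidableEq ι] (M : Matrix ι ι ℂ) (μ : ι → ℝ) : Prop :=
  ∃ U : Matrix ι ι ℂ, U * U.conjTranspose = 1 ∧ U.conjTranspose * U = 1 ∧
    M = U * Matrix.diagonal (fun i => (μ i : ℂ)) * U.conjTranspose

/-- `X` has singular values `s 1 ≥ s 2 ≥ ... ≥ s q ≥ 0` where `q = min(#rows, #cols)`:
`s` is weakly decreasing and nonnegative on `1..q`, and the eigenvalues of `Xᴴ * X`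
are `s 1 ^ 2, ..., s q ^ 2` together with `#cols - q` zeros. -/
def HasSVals {ι κ : Type} [Fintype ι] [Fintype κ] [DecidableEq κ]
    (X : Matrix ι κ ℂ) (q : ℕ) (s : ℕ → ℝ) : Prop :=
  q = min (Fintype.card ι) (Fintype.card κ) ∧
  (∀ a b, 1 ≤ a → a ≤ b → b ≤ q → s b ≤ s a) ∧
  (∀ a, 1 ≤ a → a ≤ q → 0 ≤ s a) ∧
  ∃ e : κ ≃ Fin (Fintype.card κ),
    HasEigs (X.conjTranspose * X)
      (fun j => if (e j : ℕ) + 1 ≤ q then s ((e j : ℕ) + 1) ^ 2 else 0)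

open MeasureTheory Matrix Polynomial

noncomputable instance unitaryGroup.measurableSpace (n : ℕ) :
    MeasurableSpace (unitaryGroup (Fin n) ℂ) := borel _

instance unitaryGroup.borelSpace (n : ℕ) : BorelSpace (unitaryGroup (Fin n) ℂ) := ⟨rfl⟩

instance unitaryGroup.secondCountableTopology (n : ℕ) :
    SecondCountableTopology (unitaryGroup (Fin n) ℂ) := by
  have : SecondCountableTopology (Matrix (Fin n) (Fin n) ℂ) :=
    inferInstanceAs (SecondCountableTopology (Fin n → Fin n → ℂ))
  exact TopologicalSpace.Subtype.secondCountableTopology _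

instance unitaryGroup.t2Space (n : ℕ) : T2Space (unitaryGroup (Fin n) ℂ) := by
  have : T2Space (Matrix (Fin n) (Fin n) ℂ) :=
    inferInstanceAs (T2Space (Fin n → Fin n → ℂ))
  infer_instance

instance unitaryGroup.compactSpace (n : ℕ) : CompactSpace (unitaryGroup (Fin n) ℂ) := by
  apply isCompact_iff_compactSpace.mp
  have hK : IsCompact (Set.pi Set.univ fun _ : Fin n => Set.pi Set.univ fun _ : Fin n =>
      Metric.closedBall (0 : ℂ) 1) :=
    isCompact_univ_pi fun _ => isCompact_univ_pi fun _ => isCompact_closedBall _ _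
  refine hK.of_isClosed_subset ?_ ?_
  · have : IsClosed {U : Matrix (Fin n) (Fin n) ℂ | U * star U = 1} := by
      have : T2Space (Matrix (Fin n) (Fin n) ℂ) :=
        inferInstanceAs (T2Space (Fin n → Fin n → ℂ))
      exact isClosed_eq (by fun_prop) continuous_const
    have h : (unitaryGroup (Fin n) ℂ : Set (Matrix (Fin n) (Fin n) ℂ)) = {U | U * star U = 1} :=
      Set.ext fun U => mem_unitaryGroup_iff
    rw [h]
    exact this
  · intro U hU i _ j _
    simpa using entry_norm_bound_of_unitary hU i j

/-- Normalised Haar measure on the unitary group. -/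
noncomputable def haarU (n : ℕ) : Measure (unitaryGroup (Fin n) ℂ) :=
  Measure.haarMeasure ⊤

instance (n : ℕ) : (haarU n).IsHaarMeasure := by unfold haarU; infer_instance

instance (n : ℕ) : IsProbabilityMeasure (haarU n) :=
  ⟨by
    have := Measure.haarMeasure_self
      (K₀ := (⊤ : TopologicalSpace.PositiveCompacts (unitaryGroup (Fin n) ℂ)))
    simpa [haarU] using this⟩

instance (n : ℕ) : (haarU n).IsMulRightInvariant := by
  constructor
  intro g
  have : IsProbabilityMeasure (Measure.map (· * g) (haarU n)) :=
    Measure.isProbabilityMeasure_map (by fun_prop)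
  have h := Measure.isMulInvariant_eq_smul_of_compactSpace (Measure.map (· * g) (haarU n)) (haarU n)
  have h1 := congrArg (fun m : Measure _ => m Set.univ) h
  simp only [measure_univ, Measure.smul_apply] at h1
  rw [h]
  have : Measure.haarScalarFactor (Measure.map (· * g) (haarU n)) (haarU n) = 1 := by
    rw [ENNReal.smul_def] at h1
    simpa using h1.symm
  rw [this, one_smul]

lemma map_pi_mul_normSq : Measure.map (fun z : ℂ => Real.pi * ‖z‖ ^ 2) volume
    = volume.restrict (Set.Ioi (0 : ℝ)) := by
  have hm : Measurable (fun z : ℂ => Real.pi * ‖z‖ ^ 2) := by fun_prop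
  have key : ∀ b : ℝ, Measure.map (fun z : ℂ => Real.pi * ‖z‖ ^ 2) volume (Set.Iio b)
      = ENNReal.ofReal b := by
    intro b
    rw [Measure.map_apply hm measurableSet_Iio]
    rcases le_or_gt b 0 with hb | hb
    · rw [ENNReal.ofReal_of_nonpos hb]
      have : (fun z : ℂ => Real.pi * ‖z‖ ^ 2) ⁻¹' Set.Iio b = ∅ := by
        ext z
        simp only [Set.mem_preimage, Set.mem_Iio, Set.mem_empty_iff_false, iff_false, not_lt]
        exact hb.trans (by positivity)
      rw [this, measure_empty]
    · have : (fun z : ℂ => Real.pi * ‖z‖ ^ 2) ⁻¹' Set.Iio b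
          = Metric.ball 0 (Real.sqrt (b / Real.pi)) := by
        ext z
        simp only [Set.mem_preimage, Set.mem_Iio, Metric.mem_ball, dist_zero_right]
        rw [Real.lt_sqrt (norm_nonneg _), lt_div_iff₀ Real.pi_pos, mul_comm]
      rw [this, Complex.volume_ball, ← ENNReal.ofReal_pow (by positivity),
        Real.sq_sqrt (by positivity), ← ENNReal.ofReal_coe_nnreal,
        ← ENNReal.ofReal_mul (by positivity)]
      congr 1
      simp [field]
  have key' : ∀ b : ℝ, volume.restrict (Set.Ioi (0 : ℝ)) (Set.Iio b) = ENNReal.ofReal b := by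
    intro b
    rw [Measure.restrict_apply measurableSet_Iio, Set.inter_comm, Set.Ioi_inter_Iio,
      Real.volume_Ioo, sub_zero]
  symm
  refine Measure.ext_of_Ico _ _ fun a b hab => ?_
  have hI : Set.Ico a b = Set.Iio b \ Set.Iio a := by
    ext x; simp
  have hsub : Set.Iio a ⊆ Set.Iio b := Set.Iio_subset_Iio hab.le
  rw [hI, measure_sdiff hsub measurableSet_Iio.nullMeasurableSet (by rw [key']; simp),
    measure_sdiff hsub measurableSet_Iio.nullMeasurableSet (by rw [key]; simp),
    key, key, key', key']

/-- The positive orthant. -/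
def posOrthant (m : ℕ) : Set (Fin m → ℝ) := Set.univ.pi fun _ => Set.Ioi 0

lemma measurableSet_posOrthant (m : ℕ) : MeasurableSet (posOrthant m) :=
  MeasurableSet.univ_pi fun _ => measurableSet_Ioi

lemma measurable_pi_mul_normSq (m : ℕ) :
    Measurable (fun (z : Fin m → ℂ) k => Real.pi * ‖z k‖ ^ 2) := by fun_prop

lemma map_pi_mul_normSq_pi (m : ℕ) :
    Measure.map (fun (z : Fin m → ℂ) k => Real.pi * ‖z k‖ ^ 2) volume
      = volume.restrict (posOrthant m) := by
  have : ∀ _ : Fin m, SigmaFinite (Measure.map (fun z : ℂ => Real.pi * ‖z‖ ^ 2) volume) := by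
    intro _
    rw [map_pi_mul_normSq]
    infer_instance
  rw [posOrthant, volume_pi, volume_pi, Measure.pi_map_pi (hμ := this)
    (f := fun _ : Fin m => fun z : ℂ => Real.pi * ‖z‖ ^ 2) (fun _ => by fun_prop),
    Measure.restrict_pi_pi]
  simp_rw [map_pi_mul_normSq]

lemma integral_comp_pi_mul_normSq {m : ℕ} {g : (Fin m → ℝ) → ℂ} (hg : Measurable g) :
    ∫ z : Fin m → ℂ, g (fun k => Real.pi * ‖z k‖ ^ 2) = ∫ t in posOrthant m, g t := by
  rw [← map_pi_mul_normSq_pi, integral_map (measurable_pi_mul_normSq m).aemeasurable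
    hg.aestronglyMeasurable]

lemma integral_exp_neg_sum_posOrthant (m : ℕ) :
    ∫ t in posOrthant m, Real.exp (-∑ k, t k) = 1 := by
  rw [posOrthant, volume_pi, Measure.restrict_pi_pi]
  simp_rw [← Finset.sum_neg_distrib, Real.exp_sum]
  rw [integral_fintype_prod_eq_prod (fun (_ : Fin m) (t : ℝ) => Real.exp (-t))]
  simp only [integral_exp_neg_Ioi_zero, Finset.prod_const_one]

lemma integrable_exp_neg_sum_posOrthant (m : ℕ) :
    IntegrableOn (fun t : Fin m → ℝ => Real.exp (-∑ k, t k)) (posOrthant m) := by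
  by_contra h
  have := integral_undef h
  rw [integral_exp_neg_sum_posOrthant] at this
  norm_num at this

lemma integrable_gaussian_pi (m : ℕ) :
    Integrable (fun z : Fin m → ℂ => Real.exp (-∑ k, Real.pi * ‖z k‖ ^ 2)) := by
  have h := integrable_exp_neg_sum_posOrthant m
  rw [IntegrableOn, ← map_pi_mul_normSq_pi, integrable_map_measure
    (by fun_prop) (measurable_pi_mul_normSq m).aemeasurable] at h
  exact h

lemma integral_gaussian_pi (m : ℕ) :
    ∫ z : Fin m → ℂ, Real.exp (-∑ k, Real.pi * ‖z k‖ ^ 2) = 1 := by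
  rw [← integral_exp_neg_sum_posOrthant m, ← map_pi_mul_normSq_pi, integral_map
    (measurable_pi_mul_normSq m).aemeasurable (by fun_prop)]

lemma exists_unitary_row_eq {n : ℕ} (z : Fin (n + 1) → ℂ) (hz : z ≠ 0) :
    ∃ W : unitaryGroup (Fin (n + 1)) ℂ, ∃ r : ℝ, 0 < r ∧ z = (r : ℂ) • W.1 0 := by
  set z' : EuclideanSpace ℂ (Fin (n + 1)) := WithLp.toLp 2 z with hz'
  have hz'0 : z' ≠ 0 := by
    intro h
    exact hz (by simpa [hz'] using h)
  have hr : 0 < ‖z'‖ := norm_pos_iff.mpr hz'0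
  have hrc : (‖z'‖ : ℂ) ≠ 0 := by exact_mod_cast hr.ne'
  set v : Fin (n + 1) → EuclideanSpace ℂ (Fin (n + 1)) := fun _ => ((‖z'‖ : ℂ)⁻¹) • z' with hv
  have ho : Orthonormal ℂ (Set.domRestrict ({0} : Set (Fin (n + 1))) v) := by
    constructor
    · intro i
      simp [hv, norm_smul, hr.ne']
    · intro i j hij
      exact (hij (Subsingleton.elim _ _)).elim
  obtain ⟨b, hb⟩ := ho.exists_orthonormalBasis_extension_of_card_eq (by simp)
  refine ⟨⟨Matrix.of fun i k => b i k, ?_⟩, ‖z'‖, hr, ?_⟩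
  · rw [mem_unitaryGroup_iff]
    ext i j
    have h := orthonormal_iff_ite.mp b.orthonormal j i
    rw [Matrix.mul_apply, Matrix.one_apply]
    rw [PiLp.inner_apply] at h
    simp only [star_apply, of_apply]
    convert h using 1
    · simp
    · exact if_congr eq_comm rfl rfl
  · have h0 := hb 0 rfl
    ext k
    simp only [Pi.smul_apply, of_apply, h0, hv, PiLp.smul_apply, smul_eq_mul]
    rw [mul_inv_cancel_left₀ hrc]

lemma sum_norm_sq_vecMul {n : ℕ} (U : unitaryGroup (Fin n) ℂ) (z : Fin n → ℂ) :
    ∑ k, ‖(z ᵥ* U.1) k‖ ^ 2 = ∑ k, ‖z k‖ ^ 2 := by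
  have h : ∀ w : Fin n → ℂ, ((∑ k, ‖w k‖ ^ 2 : ℝ) : ℂ) = w ⬝ᵥ star w := by
    intro w
    simp [dotProduct, Complex.mul_conj']
  have h2 : ((∑ k, ‖(z ᵥ* U.1) k‖ ^ 2 : ℝ) : ℂ) = ((∑ k, ‖z k‖ ^ 2 : ℝ) : ℂ) := by
    rw [h, h, star_vecMul, ← dotProduct_mulVec, mulVec_mulVec]
    have : U.1 * U.1ᴴ = 1 := mem_unitaryGroup_iff.mp U.2
    rw [this, one_mulVec]
  exact_mod_cast h2

lemma map_vecMul_volume {n : ℕ} (U : unitaryGroup (Fin n) ℂ) :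
    Measure.map (fun z : Fin n → ℂ => z ᵥ* U.1) volume = volume := by
  have hdet : LinearMap.det ((Matrix.toLin' U.1ᵀ).restrictScalars ℝ) = 1 := by
    rw [LinearMap.det_restrictScalars, Algebra.norm_complex_apply, LinearMap.det_toLin',
      det_transpose]
    have h := (det_of_mem_unitary U.2)
    rw [Unitary.mem_iff_self_mul_star] at h
    have h2 : ((Complex.normSq U.1.det : ℝ) : ℂ) = 1 := by
      rw [← Complex.mul_conj]; exact h
    exact_mod_cast h2
  have h := Measure.map_linearMap_addHaar_eq_smul_addHaar (volume : Measure (Fin n → ℂ))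
    (f := (Matrix.toLin' U.1ᵀ).restrictScalars ℝ) (by rw [hdet]; exact one_ne_zero)
  rw [hdet] at h
  simp only [inv_one, abs_one, ENNReal.ofReal_one, one_smul] at h
  have hf : (fun z : Fin n → ℂ => z ᵥ* U.1) = (Matrix.toLin' U.1ᵀ).restrictScalars ℝ := by
    funext z
    simp [mulVec_transpose]
  rw [hf, h]

lemma integral_gaussian_eq_integral_row {n : ℕ} {G : (Fin (n + 1) → ℂ) → ℂ} (hG : Measurable G)
    {K : ℝ} (hb : ∀ z, ‖G z‖ ≤ K) (hs : ∀ r : ℝ, 0 < r → ∀ z, G ((r : ℂ) • z) = G z) :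
    ∫ z : Fin (n + 1) → ℂ, ((Real.exp (-∑ k, Real.pi * ‖z k‖ ^ 2) : ℝ) : ℂ) * G z
      = ∫ U, G (U.1 0) ∂haarU (n + 1) := by
  set e : (Fin (n + 1) → ℂ) → ℂ := fun z => ((Real.exp (-∑ k, Real.pi * ‖z k‖ ^ 2) : ℝ) : ℂ) with he
  have hem : Measurable e := by fun_prop
  have hei : Integrable e := (integrable_gaussian_pi (n + 1)).ofReal
  have hmul : Continuous fun q : unitaryGroup (Fin (n + 1)) ℂ × (Fin (n + 1) → ℂ) =>
      q.2 ᵥ* q.1.1 := by fun_prop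
  have hinv : ∀ U : unitaryGroup (Fin (n + 1)) ℂ,
      ∫ z, e z * G (z ᵥ* U.1) = ∫ z, e z * G z := by
    intro U
    have hm : Measurable fun z : Fin (n + 1) → ℂ => z ᵥ* U.1 := by fun_prop
    conv_rhs => rw [← map_vecMul_volume U]
    rw [integral_map hm.aemeasurable (by fun_prop)]
    have : ∀ z : Fin (n + 1) → ℂ, e (z ᵥ* U.1) = e z := by
      intro z
      simp only [he, ← Finset.mul_sum, sum_norm_sq_vecMul]
    simp_rw [this]
  have hconst : ∀ z : Fin (n + 1) → ℂ, z ≠ 0 →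
      ∫ U, G (z ᵥ* U.1) ∂haarU (n + 1) = ∫ U, G (U.1 0) ∂haarU (n + 1) := by
    intro z hz
    obtain ⟨W, r, hr, hzW⟩ := exists_unitary_row_eq z hz
    rw [← integral_mul_left_eq_self (fun U : unitaryGroup (Fin (n + 1)) ℂ => G (U.1 0)) W]
    refine integral_congr_ae (.of_forall fun U => ?_)
    simp only [hzW, smul_vecMul]
    rw [hs r hr]
    rfl
  calc ∫ z, e z * G z = ∫ _U : unitaryGroup (Fin (n + 1)) ℂ, (∫ z, e z * G z) ∂haarU (n + 1) := by
        simp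
    _ = ∫ U, (∫ z, e z * G (z ᵥ* U.1)) ∂haarU (n + 1) := by simp_rw [hinv]
    _ = ∫ z, (∫ U, e z * G (z ᵥ* U.1) ∂haarU (n + 1)) := by
        refine integral_integral_swap ?_
        refine Integrable.mono' (g := fun q => ‖e q.2‖ * K)
          (((hei.norm.mul_const K).comp_snd (haarU (n + 1)))) ?_ (.of_forall fun q => ?_)
        · exact ((hem.comp measurable_snd).mul (hG.comp hmul.measurable)).aestronglyMeasurable
        · simp only [Function.uncurry, norm_mul]
          gcongr
          exact hb _
    _ = ∫ z, e z * ∫ U, G (U.1 0) ∂haarU (n + 1) := by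
        refine integral_congr_ae ?_
        have : ∀ᵐ z : Fin (n + 1) → ℂ, z ≠ 0 := by
          simp [ae_iff]
        filter_upwards [this] with z hz
        rw [integral_const_mul, hconst z hz]
    _ = ∫ U, G (U.1 0) ∂haarU (n + 1) := by
        rw [integral_mul_const]
        have : ∫ z, e z = 1 := by
          rw [he, integral_complex_ofReal, integral_gaussian_pi, Complex.ofReal_one]
        rw [this, one_mul]

/-- The squared moduli of the entries of the first row of a Haar unitary matrix are distributed as
the normalisation of a vector of independent exponential variables. -/
lemma integral_norm_sq_row {n : ℕ} {g : (Fin (n + 1) → ℝ) → ℂ} (hg : Measurable g)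
    {K : ℝ} (hb : ∀ t, ‖g t‖ ≤ K) (hs : ∀ r : ℝ, 0 < r → ∀ t, g (r • t) = g t) :
    ∫ U, g (fun k => ‖U.1 0 k‖ ^ 2) ∂haarU (n + 1)
      = ∫ t in posOrthant (n + 1), ((Real.exp (-∑ k, t k) : ℝ) : ℂ) * g t := by
  have h := integral_gaussian_eq_integral_row (G := fun z => g fun k => ‖z k‖ ^ 2)
    (hg.comp (by fun_prop)) (fun _ => hb _) (fun r hr z => by
      rw [← hs (r ^ 2) (by positivity) (fun k => ‖z k‖ ^ 2)]
      congr 1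
      ext k
      simp [mul_pow])
  rw [← h, ← integral_comp_pi_mul_normSq (by fun_prop)]
  refine integral_congr_ae (.of_forall fun z => ?_)
  simp only
  congr 1
  rw [← hs Real.pi Real.pi_pos]
  rfl

/-- Parametrisation of the positive orthant by a scale `v 0` and the points `v j.succ` interlacing
the nodes `α`, through the partial fraction expansion of `v 0 * ∏ j, (X - v j.succ)` over
`∏ k, (X - α k)`. -/
noncomputable def residueMap {n : ℕ} (α : Fin (n + 1) → ℝ) (v : Fin (n + 1) → ℝ) :
    Fin (n + 1) → ℝ :=
  fun k => v 0 * ∏ j : Fin n, ((α k - v j.succ) / (α k - α (k.succAbove j)))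

/-- The domain of `residueMap`. -/
def interlaceSet {n : ℕ} (α : Fin (n + 1) → ℝ) : Set (Fin (n + 1) → ℝ) :=
  Set.univ.pi (Fin.cons (Set.Ioi 0) fun j : Fin n => Set.Ioo (α j.castSucc) (α j.succ))

lemma mem_interlaceSet {n : ℕ} {α v : Fin (n + 1) → ℝ} :
    v ∈ interlaceSet α ↔ 0 < v 0 ∧ ∀ j : Fin n, α j.castSucc < v j.succ ∧ v j.succ < α j.succ := by
  simp [interlaceSet, Set.mem_pi, Fin.forall_fin_succ]

lemma measurableSet_interlaceSet {n : ℕ} (α : Fin (n + 1) → ℝ) :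
    MeasurableSet (interlaceSet α) := by
  refine MeasurableSet.univ_pi fun i => ?_
  refine Fin.cases ?_ (fun j => ?_) i
  · exact measurableSet_Ioi
  · exact measurableSet_Ioo

lemma residueMap_smul {n : ℕ} (α v : Fin (n + 1) → ℝ) (r : ℝ) :
    residueMap α (Fin.cons (r * v 0) fun j => v j.succ) = r • residueMap α v := by
  ext k
  simp [residueMap, mul_assoc]

lemma sub_succAbove_ne_zero {n : ℕ} {α : Fin (n + 1) → ℝ} (hα : StrictMono α) (k : Fin (n + 1))
    (j : Fin n) : α k - α (k.succAbove j) ≠ 0 :=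
  sub_ne_zero.mpr (hα.injective.ne (Fin.succAbove_ne k j).symm)

lemma residueMap_pos {n : ℕ} {α v : Fin (n + 1) → ℝ} (hα : StrictMono α)
    (hv : v ∈ interlaceSet α) (k : Fin (n + 1)) : 0 < residueMap α v k := by
  rw [mem_interlaceSet] at hv
  refine mul_pos hv.1 (Finset.prod_pos fun j _ => ?_)
  rcases lt_or_ge j.castSucc k with h | h
  · rw [Fin.succAbove_of_castSucc_lt _ _ h]
    have h1 : α j.succ ≤ α k := hα.monotone (Fin.castSucc_lt_iff_succ_le.mp h)
    exact div_pos (by linarith [(hv.2 j).2]) (by linarith [(hv.2 j).2, (hv.2 j).1])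
  · rw [Fin.succAbove_of_le_castSucc _ _ h]
    have h1 : α k ≤ α j.castSucc := hα.monotone h
    exact div_pos_of_neg_of_neg (by linarith [(hv.2 j).1]) (by linarith [(hv.2 j).2, (hv.2 j).1])

/-- The numerator polynomial with residues `t` at the nodes `α`. -/
noncomputable def residuePoly {n : ℕ} (α t : Fin (n + 1) → ℝ) : ℝ[X] :=
  ∑ k, C (t k) * ∏ j : Fin n, (X - C (α (k.succAbove j)))

lemma eval_residuePoly_node {n : ℕ} (α t : Fin (n + 1) → ℝ) (k : Fin (n + 1)) :
    (residuePoly α t).eval (α k) = t k * ∏ j : Fin n, (α k - α (k.succAbove j)) := by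
  rw [residuePoly, eval_finsetSum, Finset.sum_eq_single k]
  · simp [eval_prod]
  · intro i _ hi
    obtain ⟨j, hj⟩ := Fin.exists_succAbove_eq hi.symm
    simp only [eval_mul, eval_C, eval_prod, eval_sub, eval_X, mul_eq_zero]
    exact Or.inr (Finset.prod_eq_zero (Finset.mem_univ j) (by rw [hj, sub_self]))
  · simp

lemma natDegree_prod_X_sub_C_eq {n : ℕ} (b : Fin n → ℝ) :
    (∏ j, (X - C (b j))).natDegree = n := by
  simp [natDegree_prod_of_monic _ _ fun j _ => monic_X_sub_C (b j)]

lemma coeff_prod_X_sub_C {n : ℕ} (b : Fin n → ℝ) :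
    (∏ j, (X - C (b j))).coeff n = 1 := by
  have h : (∏ j, (X - C (b j))).Monic := monic_prod_of_monic _ _ fun j _ => monic_X_sub_C (b j)
  rw [Monic, leadingCoeff, natDegree_prod_X_sub_C_eq] at h
  exact h

lemma natDegree_residuePoly_le {n : ℕ} (α t : Fin (n + 1) → ℝ) :
    (residuePoly α t).natDegree ≤ n := by
  refine natDegree_sum_le_of_forall_le _ _ fun k _ => ?_
  exact (natDegree_C_mul_le _ _).trans (natDegree_prod_X_sub_C_eq _).le

lemma coeff_residuePoly {n : ℕ} (α t : Fin (n + 1) → ℝ) :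
    (residuePoly α t).coeff n = ∑ k, t k := by
  simp [residuePoly, coeff_C_mul, coeff_prod_X_sub_C]

lemma degree_lt_of_natDegree_le {n : ℕ} {q : ℝ[X]} (h : q.natDegree ≤ n) :
    q.degree < ((Finset.univ : Finset (Fin (n + 1))).card : WithBot ℕ) := by
  rw [Finset.card_univ, Fintype.card_fin]
  exact lt_of_le_of_lt degree_le_natDegree (by exact_mod_cast Nat.lt_succ_of_le h)

lemma residuePoly_residueMap {n : ℕ} {α : Fin (n + 1) → ℝ} (hα : StrictMono α)
    (v : Fin (n + 1) → ℝ) :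
    residuePoly α (residueMap α v) = C (v 0) * ∏ j : Fin n, (X - C (v j.succ)) := by
  refine eq_of_degrees_lt_of_eval_index_eq (v := α) Finset.univ hα.injective.injOn
    (degree_lt_of_natDegree_le (natDegree_residuePoly_le _ _))
    (degree_lt_of_natDegree_le
      ((natDegree_C_mul_le _ _).trans (natDegree_prod_X_sub_C_eq _).le)) fun k _ => ?_
  rw [eval_residuePoly_node, residueMap]
  simp only [eval_mul, eval_C, eval_prod, eval_sub, eval_X]
  rw [mul_assoc, ← Finset.prod_mul_distrib]
  congr 1
  exact Finset.prod_congr rfl fun j _ => div_mul_cancel₀ _ (sub_succAbove_ne_zero hα k j)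

lemma sum_residueMap {n : ℕ} {α : Fin (n + 1) → ℝ} (hα : StrictMono α) (v : Fin (n + 1) → ℝ) :
    ∑ k, residueMap α v k = v 0 := by
  rw [← coeff_residuePoly α, residuePoly_residueMap hα, coeff_C_mul, coeff_prod_X_sub_C, mul_one]

lemma strictMono_of_mem_interlaceSet {n : ℕ} {α v : Fin (n + 1) → ℝ} (hα : StrictMono α)
    (hv : v ∈ interlaceSet α) : StrictMono fun j : Fin n => v j.succ := by
  rw [mem_interlaceSet] at hv
  intro i j hij
  have h : α i.succ ≤ α j.castSucc := hα.monotone (by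
    rw [Fin.le_def]; simpa using hij)
  exact (hv.2 i).2.trans_le (h.trans (hv.2 j).1.le)

lemma injOn_residueMap {n : ℕ} {α : Fin (n + 1) → ℝ} (hα : StrictMono α) :
    Set.InjOn (residueMap α) (interlaceSet α) := by
  intro v hv w hw h
  have h0 : v 0 = w 0 := by rw [← sum_residueMap hα v, h, sum_residueMap hα]
  have hp := residuePoly_residueMap hα v
  rw [h, residuePoly_residueMap hα w] at hp
  rw [mem_interlaceSet] at hv hw
  ext i
  refine Fin.cases h0 (fun j => ?_) i
  have he := congrArg (eval (v j.succ)) hp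
  simp only [eval_mul, eval_C, eval_prod, eval_sub, eval_X] at he
  rw [Finset.prod_eq_zero (f := fun i : Fin n => v j.succ - v i.succ) (Finset.mem_univ j)
    (sub_self _), mul_zero, mul_eq_zero, or_iff_right hw.1.ne', Finset.prod_eq_zero_iff] at he
  obtain ⟨i, -, hi⟩ := he
  have hi' : v j.succ = w i.succ := by linarith
  have : i = j := by
    by_contra hne
    rcases lt_or_gt_of_ne hne with hlt | hlt
    · have : α i.succ ≤ α j.castSucc := hα.monotone (by rw [Fin.le_def]; simpa using hlt)
      linarith [(hw.2 i).2, (hv.2 j).1]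
    · have : α j.succ ≤ α i.castSucc := hα.monotone (by rw [Fin.le_def]; simpa using hlt)
      linarith [(hw.2 i).1, (hv.2 j).2]
  rw [hi', this]

lemma eval_residuePoly_mul_neg {n : ℕ} {α t : Fin (n + 1) → ℝ} (hα : StrictMono α)
    (ht : ∀ k, 0 < t k) (j : Fin n) :
    (residuePoly α t).eval (α j.castSucc) * (residuePoly α t).eval (α j.succ) < 0 := by
  rw [eval_residuePoly_node, eval_residuePoly_node, mul_mul_mul_comm, ← Finset.prod_mul_distrib,
    ← Finset.mul_prod_erase _ _ (Finset.mem_univ j)]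
  refine mul_neg_of_pos_of_neg (mul_pos (ht _) (ht _)) (mul_neg_of_neg_of_pos ?_ ?_)
  · rw [Fin.succAbove_of_le_castSucc _ _ le_rfl, Fin.succAbove_of_castSucc_lt _ _
      Fin.castSucc_lt_succ]
    have : α j.castSucc < α j.succ := hα Fin.castSucc_lt_succ
    nlinarith
  · refine Finset.prod_pos fun i hi => ?_
    rcases lt_or_gt_of_ne (Finset.ne_of_mem_erase hi) with h | h
    · rw [Fin.succAbove_of_castSucc_lt j.castSucc i (by simpa using h),
        Fin.succAbove_of_castSucc_lt j.succ i (by rw [Fin.lt_def] at *; simp; omega)]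
      have h1 : α i.castSucc < α j.castSucc := hα (by simpa using h)
      have h2 : α i.castSucc < α j.succ := hα (by rw [Fin.lt_def] at *; simp; omega)
      exact mul_pos (by linarith) (by linarith)
    · rw [Fin.succAbove_of_le_castSucc j.castSucc i (by simpa using h.le),
        Fin.succAbove_of_le_castSucc j.succ i
          (by rw [Fin.lt_def] at h; rw [Fin.le_def]; simp; omega)]
      have h1 : α j.castSucc < α i.succ := hα (by rw [Fin.lt_def] at *; simp; omega)
      have h2 : α j.succ < α i.succ := hα (by simpa using h)
      exact mul_pos_of_neg_of_neg (by linarith) (by linarith)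

lemma exists_root_of_mul_neg {f : ℝ → ℝ} (hf : Continuous f) {a b : ℝ} (hab : a < b)
    (h : f a * f b < 0) : ∃ c, a < c ∧ c < b ∧ f c = 0 := by
  rcases mul_neg_iff.mp h with ⟨h1, h2⟩ | ⟨h1, h2⟩
  · obtain ⟨c, hc, hc0⟩ := intermediate_value_Ioo' hab.le hf.continuousOn ⟨h2, h1⟩
    exact ⟨c, hc.1, hc.2, hc0⟩
  · obtain ⟨c, hc, hc0⟩ := intermediate_value_Ioo hab.le hf.continuousOn ⟨h1, h2⟩
    exact ⟨c, hc.1, hc.2, hc0⟩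

lemma exists_residueMap_eq {n : ℕ} {α t : Fin (n + 1) → ℝ} (hα : StrictMono α)
    (ht : ∀ k, 0 < t k) : ∃ v ∈ interlaceSet α, residueMap α v = t := by
  choose b hb1 hb2 hb3 using fun j : Fin n => exists_root_of_mul_neg
    (residuePoly α t).continuous (hα (Fin.castSucc_lt_succ (i := j)))
    (eval_residuePoly_mul_neg hα ht j)
  set v : Fin (n + 1) → ℝ := Fin.cons (∑ k, t k) b with hv
  have hvm : v ∈ interlaceSet α := by
    rw [mem_interlaceSet]
    exact ⟨by simpa [hv] using Finset.sum_pos (fun k _ => ht k) Finset.univ_nonempty,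
      fun j => by simpa [hv] using ⟨hb1 j, hb2 j⟩⟩
  have hbm : StrictMono b := by simpa [hv] using strictMono_of_mem_interlaceSet hα hvm
  have hq : residuePoly α t = C (v 0) * ∏ j : Fin n, (X - C (v j.succ)) := by
    refine eq_of_degree_sub_lt_of_eval_index_eq (v := b) Finset.univ hbm.injective.injOn ?_
      fun j _ => ?_
    · rw [Finset.card_univ, Fintype.card_fin, degree_lt_iff_coeff_zero]
      intro m hm
      rw [coeff_sub]
      rcases hm.eq_or_lt with rfl | hm
      · rw [coeff_residuePoly, coeff_C_mul, coeff_prod_X_sub_C]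
        simp [hv]
      · rw [coeff_eq_zero_of_natDegree_lt ((natDegree_residuePoly_le _ _).trans_lt hm),
          coeff_eq_zero_of_natDegree_lt
            (((natDegree_C_mul_le _ _).trans (natDegree_prod_X_sub_C_eq _).le).trans_lt hm),
          sub_zero]
    · rw [hb3]
      simp only [eval_mul, eval_C, eval_prod, eval_sub, eval_X]
      rw [Finset.prod_eq_zero (Finset.mem_univ j) (by simp [hv]), mul_zero]
  refine ⟨v, hvm, ?_⟩
  ext k
  have h1 := congrArg (eval (α k)) (residuePoly_residueMap hα v)
  rw [← hq, eval_residuePoly_node, eval_residuePoly_node] at h1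
  exact mul_right_cancel₀ (Finset.prod_ne_zero_iff.mpr fun j _ => sub_succAbove_ne_zero hα k j) h1

lemma image_residueMap {n : ℕ} {α : Fin (n + 1) → ℝ} (hα : StrictMono α) :
    residueMap α '' interlaceSet α = posOrthant (n + 1) := by
  ext t
  simp only [posOrthant, Set.mem_pi, Set.mem_univ, true_implies, Set.mem_Ioi, Set.mem_image]
  exact ⟨fun ⟨v, hv, h⟩ k => h ▸ residueMap_pos hα hv k, fun h => exists_residueMap_eq hα h⟩

lemma prod_erase_eq_prod_Ioi_sq {m : ℕ} (f : Fin m → Fin m → ℝ) (hf : ∀ i j, f i j = f j i) :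
    ∏ k, ∏ l ∈ Finset.univ.erase k, f k l = (∏ k, ∏ l ∈ Finset.Ioi k, f k l) ^ 2 := by
  have h1 : ∀ k : Fin m, ∏ l ∈ Finset.univ.erase k, f k l
      = (∏ l ∈ Finset.Iio k, f k l) * ∏ l ∈ Finset.Ioi k, f k l := by
    intro k
    rw [← Finset.prod_union (Finset.disjoint_left.mpr fun x hx hx' => by
      simp only [Finset.mem_Iio, Finset.mem_Ioi] at hx hx'; exact absurd hx hx'.asymm)]
    congr 1
    ext l
    simp
  simp_rw [h1]
  rw [Finset.prod_mul_distrib, sq]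
  congr 1
  rw [Finset.prod_comm' (t' := Finset.univ) (s' := fun l => Finset.Ioi l) (by simp)]
  exact Finset.prod_congr rfl fun k _ => Finset.prod_congr rfl fun l _ => hf _ _

lemma prod_succAbove_eq_prod_erase {n : ℕ} (k : Fin (n + 1)) (f : Fin (n + 1) → ℝ) :
    ∏ j : Fin n, f (k.succAbove j) = ∏ l ∈ Finset.univ.erase k, f l := by
  rw [← Finset.prod_image (s := Finset.univ) (g := k.succAbove) (f := f)
    Fin.succAbove_right_injective.injOn]
  congr 1
  ext l
  simp

lemma abs_det_vandermonde {m : ℕ} (a : Fin m → ℝ) :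
    |(vandermonde a).det| = ∏ k, ∏ l ∈ Finset.Ioi k, |a l - a k| := by
  rw [det_vandermonde, Finset.abs_prod]
  exact Finset.prod_congr rfl fun _ _ => Finset.abs_prod _ _

lemma prod_abs_sub_erase {m : ℕ} (a : Fin m → ℝ) :
    ∏ k, ∏ l ∈ Finset.univ.erase k, |a k - a l| = |(vandermonde a).det| ^ 2 := by
  rw [prod_erase_eq_prod_Ioi_sq (fun k l => |a k - a l|) (fun _ _ => abs_sub_comm _ _),
    abs_det_vandermonde]
  simp_rw [abs_sub_comm]

lemma det_vandermonde_pos {m : ℕ} {a : Fin m → ℝ} (ha : StrictMono a) :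
    0 < (vandermonde a).det := by
  rw [det_vandermonde]
  exact Finset.prod_pos fun i _ => Finset.prod_pos fun j hj =>
    sub_pos.mpr (ha (Finset.mem_Ioi.mp hj))

lemma eval_eq_vandermonde_mul_coeff {m : ℕ} (a : Fin m → ℝ) (q : Fin m → ℝ[X])
    (hq : ∀ i, (q i).natDegree < m) :
    (of fun k i => (q i).eval (a k)) = vandermonde a * of fun (l : Fin m) i => (q i).coeff l := by
  ext k i
  rw [of_apply, mul_apply, eval_eq_sum_range' (hq i), Finset.sum_range]
  exact Finset.sum_congr rfl fun l _ => by simp [vandermonde_apply, mul_comm]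

/-- The monic polynomial with roots `b` followed by its derivatives with respect to the roots,
up to sign. -/
noncomputable def rootPolys {n : ℕ} (b : Fin n → ℝ) : Fin (n + 1) → ℝ[X] :=
  Fin.cons (∏ j, (X - C (b j))) fun j => ∏ i ∈ Finset.univ.erase j, (X - C (b i))

lemma natDegree_rootPolys_lt {n : ℕ} (b : Fin n → ℝ) (i : Fin (n + 1)) :
    (rootPolys b i).natDegree < n + 1 := by
  refine Fin.cases ?_ (fun j => ?_) i
  · simp [rootPolys]
  · simp only [rootPolys, Fin.cons_succ]
    rw [natDegree_prod_of_monic _ _ fun i _ => monic_X_sub_C (b i)]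
    simp

lemma abs_det_coeff_rootPolys {n : ℕ} {b : Fin n → ℝ} (hb : Function.Injective b) :
    |(of fun (l : Fin (n + 1)) i => (rootPolys b i).coeff l).det| = |(vandermonde b).det| := by
  obtain ⟨t, ht⟩ := Infinite.exists_notMem_finset (Finset.univ.image b)
  have ht' : ∀ j, b j - t ≠ 0 := fun j h => ht (by
    rw [Finset.mem_image]; exact ⟨j, Finset.mem_univ _, sub_eq_zero.mp h⟩)
  have h := congrArg (fun M => |M.det|)
    (eval_eq_vandermonde_mul_coeff (Fin.cons t b) (rootPolys b) (natDegree_rootPolys_lt b))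
  simp only [det_mul, abs_mul] at h
  have hL : |(of fun k i => (rootPolys b i).eval ((Fin.cons t b : Fin (n + 1) → ℝ) k)).det|
      = (∏ j, |b j - t|) * |(vandermonde b).det| ^ 2 := by
    rw [det_succ_column_zero, Fin.sum_univ_succ, Finset.sum_eq_zero]
    · have hd : ((of fun k i => (rootPolys b i).eval ((Fin.cons t b : Fin (n + 1) → ℝ) k)).submatrix
          (Fin.succAbove 0) Fin.succ)
          = diagonal fun j => ∏ i ∈ Finset.univ.erase j, (b j - b i) := by
        ext k j
        rcases eq_or_ne k j with rfl | hne
        · simp [rootPolys, eval_prod]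
        · rw [diagonal_apply_ne _ hne]
          simp only [rootPolys, submatrix_apply, of_apply, Fin.succAbove_zero, Fin.cons_succ,
            eval_prod, eval_sub, eval_X, eval_C]
          exact Finset.prod_eq_zero (Finset.mem_erase.mpr ⟨hne, Finset.mem_univ k⟩) (sub_self _)
      rw [hd, det_diagonal]
      simp only [rootPolys, of_apply, Fin.cons_zero, eval_prod, eval_sub, eval_X, eval_C, add_zero,
        abs_mul, Finset.abs_prod, prod_abs_sub_erase]
      simp [abs_sub_comm]
    · intro i _
      have : eval (b i) (∏ j, (X - C (b j))) = 0 := by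
        rw [eval_prod]; exact Finset.prod_eq_zero (Finset.mem_univ i) (by simp)
      simp [rootPolys, this]
  have hR : |(vandermonde (Fin.cons t b : Fin (n + 1) → ℝ)).det|
      = (∏ j, |b j - t|) * |(vandermonde b).det| := by
    rw [abs_det_vandermonde, abs_det_vandermonde, Fin.prod_univ_succ, Fin.prod_Ioi_zero]
    simp [Fin.prod_Ioi_succ]
  rw [hL, hR, sq, ← mul_assoc] at h
  refine (mul_left_cancel₀ ?_ h).symm
  refine mul_ne_zero (Finset.prod_ne_zero_iff.mpr fun j _ => abs_ne_zero.mpr (ht' j)) ?_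
  exact abs_ne_zero.mpr (det_vandermonde_ne_zero_iff.mpr hb)

/-- The Jacobian matrix of `residueMap`. -/
noncomputable def residueJacobian {n : ℕ} (α v : Fin (n + 1) → ℝ) :
    Matrix (Fin (n + 1)) (Fin (n + 1)) ℝ :=
  diagonal (fun k => (∏ j : Fin n, (α k - α (k.succAbove j)))⁻¹) *
    (of fun k i => (rootPolys (fun j : Fin n => v j.succ) i).eval (α k)) *
    diagonal (Fin.cons 1 fun _ => - v 0)

lemma hasFDerivAt_residueMap {n : ℕ} (α v : Fin (n + 1) → ℝ) :
    HasFDerivAt (residueMap α) (toLin' (residueJacobian α v)).toContinuousLinearMap v := by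
  rw [hasFDerivAt_pi']
  intro k
  have h1 := ((hasFDerivAt_apply (𝕜 := ℝ) (0 : Fin (n + 1)) v).mul
    (HasFDerivAt.finsetProd (u := Finset.univ) (fun (j : Fin n) _ =>
      (hasFDerivAt_apply (𝕜 := ℝ) j.succ v).const_sub (α k)))).mul_const
      (∏ j : Fin n, (α k - α (k.succAbove j)))⁻¹
  have he : (fun w => residueMap α w k) = fun w : Fin (n + 1) → ℝ =>
      w 0 * (∏ j : Fin n, (α k - w j.succ)) * (∏ j : Fin n, (α k - α (k.succAbove j)))⁻¹ := by
    funext w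
    rw [residueMap, Finset.prod_div_distrib, mul_div_assoc', div_eq_mul_inv]
  rw [he]
  refine h1.congr_fderiv ?_
  ext w
  simp only [ContinuousLinearMap.comp_apply, _root_.smul_apply,
    _root_.add_apply, _root_.sum_apply, ContinuousLinearMap.proj_apply,
    LinearMap.coe_toContinuousLinearMap', toLin'_apply, mulVec, dotProduct, residueJacobian,
    diagonal_mul, mul_diagonal, of_apply, Fin.sum_univ_succ, rootPolys, Fin.cons_zero,
    Fin.cons_succ, eval_prod, eval_sub, eval_X, eval_C, smul_eq_mul, _root_.neg_apply,
    Finset.mul_sum, mul_add]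
  rw [add_comm]
  congr 1
  · ring
  · exact Finset.sum_congr rfl fun j _ => by ring

lemma abs_det_residueJacobian {n : ℕ} {α v : Fin (n + 1) → ℝ} (hα : StrictMono α)
    (hv : v ∈ interlaceSet α) :
    |(residueJacobian α v).det|
      = v 0 ^ n * (vandermonde fun j : Fin n => v j.succ).det / (vandermonde α).det := by
  have hb := strictMono_of_mem_interlaceSet hα hv
  have hv0 : 0 < v 0 := (mem_interlaceSet.mp hv).1
  have hVα := det_vandermonde_pos hα
  have hVb := det_vandermonde_pos hb
  rw [residueJacobian, det_mul, det_mul, det_diagonal, det_diagonal,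
    eval_eq_vandermonde_mul_coeff _ _ (natDegree_rootPolys_lt _), det_mul, abs_mul, abs_mul,
    abs_mul, abs_det_coeff_rootPolys hb.injective, Finset.abs_prod, Finset.abs_prod]
  have hD : ∀ k, |(∏ j : Fin n, (α k - α (k.succAbove j)))⁻¹|
      = (∏ l ∈ Finset.univ.erase k, |α k - α l|)⁻¹ := fun k => by
    rw [abs_inv, Finset.abs_prod, prod_succAbove_eq_prod_erase k fun l => |α k - α l|]
  simp_rw [hD]
  rw [Finset.prod_inv_distrib, prod_abs_sub_erase, abs_of_pos hVα, abs_of_pos hVb,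
    Fin.prod_univ_succ]
  simp only [Fin.cons_zero, abs_one, Fin.cons_succ, abs_neg, abs_of_pos hv0, Finset.prod_const,
    Finset.card_univ, Fintype.card_fin]
  field_simp

lemma exists_perm_of_prod_X_sub_C_eq {ι : Type} [Fintype ι] {μ ν : ι → ℝ}
    (h : ∏ i, (X - C (μ i : ℂ)) = ∏ i, (X - C (ν i : ℂ))) : ∃ σ : Equiv.Perm ι, ν = μ ∘ σ := by
  have h1 := congrArg Polynomial.roots h
  rw [roots_prod _ _ (Finset.prod_ne_zero_iff.mpr fun i _ => X_sub_C_ne_zero _),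
    roots_prod _ _ (Finset.prod_ne_zero_iff.mpr fun i _ => X_sub_C_ne_zero _)] at h1
  simp only [roots_X_sub_C, Multiset.bind_singleton] at h1
  have h2 : ∀ c : ℂ, Nonempty ({i // (ν i : ℂ) = c} ≃ {i // (μ i : ℂ) = c}) := by
    intro c
    have h3 := congrArg (Multiset.count c) h1
    rw [Multiset.count_map, Multiset.count_map] at h3
    rw [← Fintype.card_eq, Fintype.card_subtype, Fintype.card_subtype]
    simp only [eq_comm (b := c)]
    exact h3.symm
  refine ⟨Equiv.ofFiberEquiv fun c => (h2 c).some, ?_⟩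
  funext i
  have := Equiv.ofFiberEquiv_map (fun c => (h2 c).some) i
  exact (Complex.ofReal_injective this).symm

section HasEigs

variable {ι : Type} [Fintype ι] [DecidableEq ι] {M : Matrix ι ι ℂ} {μ : ι → ℝ}

lemma HasEigs.isHermitian (h : HasEigs M μ) : M.IsHermitian := by
  obtain ⟨U, -, -, rfl⟩ := h
  refine isHermitian_mul_mul_conjTranspose U ?_
  rw [isHermitian_diagonal_iff]
  intro i
  simp [isSelfAdjoint_iff]

lemma HasEigs.charpoly_eq (h : HasEigs M μ) : M.charpoly = ∏ i, (X - C (μ i : ℂ)) := by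
  obtain ⟨U, h1, h2, rfl⟩ := h
  rw [mul_assoc, charpoly_mul_comm, mul_assoc, h2, mul_one, charpoly_diagonal]

lemma hasEigs_diagonal (μ : ι → ℝ) : HasEigs (diagonal fun i => (μ i : ℂ)) μ :=
  ⟨1, by simp, by simp, by simp⟩

lemma HasEigs.perm (h : HasEigs M μ) (σ : Equiv.Perm ι) : HasEigs M (μ ∘ σ) := by
  obtain ⟨U, h1, h2, rfl⟩ := h
  refine ⟨U.submatrix id σ, ?_, ?_, ?_⟩
  · rw [conjTranspose_submatrix, submatrix_mul_equiv, h1, submatrix_id_id]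
  · have := submatrix_mul_equiv Uᴴ U σ (Equiv.refl ι) σ
    rw [Equiv.coe_refl] at this
    rw [conjTranspose_submatrix, this, h2, submatrix_one_equiv]
  · have : (diagonal fun i => (((μ ∘ σ) i : ℝ) : ℂ))
        = (diagonal fun i => (μ i : ℂ)).submatrix σ σ := by
      rw [submatrix_diagonal_equiv]; rfl
    rw [this, conjTranspose_submatrix, submatrix_mul_equiv, submatrix_mul_equiv, submatrix_id_id]

lemma Matrix.IsHermitian.hasEigs (h : M.IsHermitian) : HasEigs M h.eigenvalues := by
  refine ⟨h.eigenvectorUnitary.1, ?_, ?_, ?_⟩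
  · exact mem_unitaryGroup_iff.mp h.eigenvectorUnitary.2
  · exact mem_unitaryGroup_iff'.mp h.eigenvectorUnitary.2
  · conv_lhs => rw [h.spectral_theorem]
    simp [Unitary.conjStarAlgAut_apply]
    rfl

lemma hasEigs_of_charpoly_eq (h : M.IsHermitian) (hM : M.charpoly = ∏ i, (X - C (μ i : ℂ))) :
    HasEigs M μ := by
  obtain ⟨σ, hσ⟩ := exists_perm_of_prod_X_sub_C_eq (h.hasEigs.charpoly_eq.symm.trans hM)
  rw [hσ]
  exact h.hasEigs.perm σ

end HasEigs

/-- The character `M ↦ exp (i ∑ k, x k * Re (M k k))`. -/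
noncomputable def diagChar {n : ℕ} (x : Fin n → ℝ) (M : Matrix (Fin n) (Fin n) ℂ) : ℂ :=
  Complex.exp (((∑ k, x k * (M k k).re : ℝ) : ℂ) * Complex.I)

lemma norm_diagChar {n : ℕ} (x : Fin n → ℝ) (M : Matrix (Fin n) (Fin n) ℂ) :
    ‖diagChar x M‖ = 1 := Complex.norm_exp_ofReal_mul_I _

lemma continuous_diagChar {n : ℕ} (x : Fin n → ℝ) : Continuous (diagChar x) := by
  have : ∀ k : Fin n, Continuous fun M : Matrix (Fin n) (Fin n) ℂ => M k k := fun k =>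
    continuous_id.matrix_elem k k
  unfold diagChar
  fun_prop

/-- The average of `diagChar x` over the unitary orbit of `M`. -/
noncomputable def orbitChar {n : ℕ} (x : Fin n → ℝ) (M : Matrix (Fin n) (Fin n) ℂ) : ℂ :=
  ∫ U, diagChar x (U.1 * M * U.1ᴴ) ∂haarU n

lemma norm_orbitChar_le {n : ℕ} (x : Fin n → ℝ) (M : Matrix (Fin n) (Fin n) ℂ) :
    ‖orbitChar x M‖ ≤ 1 := by
  refine (norm_integral_le_of_norm_le_const (C := 1)
    (.of_forall fun U => (norm_diagChar _ _).le)).trans ?_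
  simp

lemma continuous_orbitChar_diagonal {n : ℕ} (x : Fin n → ℝ) :
    Continuous fun a : Fin n → ℝ => orbitChar x (diagonal fun i => (a i : ℂ)) := by
  refine continuous_of_dominated (bound := fun _ => 1) (fun a => ?_)
    (fun a => .of_forall fun U => (norm_diagChar _ _).le) (integrable_const _)
    (.of_forall fun U => ?_)
  · exact ((continuous_diagChar x).comp (by fun_prop)).aestronglyMeasurable
  · exact (continuous_diagChar x).comp (by fun_prop)

lemma orbitChar_conj {n : ℕ} (x : Fin n → ℝ) (M : Matrix (Fin n) (Fin n) ℂ)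
    (W : unitaryGroup (Fin n) ℂ) : orbitChar x (W.1 * M * W.1ᴴ) = orbitChar x M := by
  unfold orbitChar
  rw [← integral_mul_right_eq_self (fun U : unitaryGroup (Fin n) ℂ =>
    diagChar x (U.1 * M * U.1ᴴ)) W]
  refine integral_congr_ae (.of_forall fun U => ?_)
  simp only [Submonoid.coe_mul, conjTranspose_mul, mul_assoc]

lemma orbitChar_of_hasEigs {n : ℕ} (x : Fin n → ℝ) {M : Matrix (Fin n) (Fin n) ℂ} {a : Fin n → ℝ}
    (h : HasEigs M a) : orbitChar x M = orbitChar x (diagonal fun i => (a i : ℂ)) := by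
  obtain ⟨U, h1, h2, rfl⟩ := h
  exact orbitChar_conj x _ ⟨U, mem_unitaryGroup_iff.mpr h1⟩

/-- The block diagonal embedding `V ↦ diag (1, V)`. -/
def bordered {n : ℕ} (V : Matrix (Fin n) (Fin n) ℂ) : Matrix (Fin (n + 1)) (Fin (n + 1)) ℂ :=
  of (Fin.cons (Fin.cons 1 0) fun i => Fin.cons 0 (V i))

lemma bordered_mul_conjTranspose {n : ℕ} {V : Matrix (Fin n) (Fin n) ℂ} (h : V * Vᴴ = 1) :
    bordered V * (bordered V)ᴴ = 1 := by
  ext i j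
  rw [mul_apply, Fin.sum_univ_succ]
  refine Fin.cases ?_ (fun i => ?_) i <;> refine Fin.cases ?_ (fun j => ?_) j
  · simp [bordered]
  · simp [bordered, one_apply, (Fin.succ_ne_zero j).symm]
  · simp [bordered, one_apply]
  · have := congrFun (congrFun h i) j
    rw [mul_apply] at this
    simpa [bordered, one_apply] using this

lemma submatrix_bordered_conj {n : ℕ} (V : Matrix (Fin n) (Fin n) ℂ)
    (M : Matrix (Fin (n + 1)) (Fin (n + 1)) ℂ) :
    (bordered V * M * (bordered V)ᴴ).submatrix Fin.succ Fin.succ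
      = V * M.submatrix Fin.succ Fin.succ * Vᴴ := by
  ext i j
  simp [mul_apply, bordered, Fin.sum_univ_succ]

lemma diagChar_succ {n : ℕ} (x : Fin (n + 1) → ℝ) (M : Matrix (Fin (n + 1)) (Fin (n + 1)) ℂ) :
    diagChar x M = Complex.exp (((x 0 * M.trace.re : ℝ) : ℂ) * Complex.I)
      * diagChar (fun i => x i.succ - x 0) (M.submatrix Fin.succ Fin.succ) := by
  rw [diagChar, diagChar, ← Complex.exp_add, ← add_mul, ← Complex.ofReal_add]
  congr 4
  simp only [trace, diag_apply, Fin.sum_univ_succ, submatrix_apply, Complex.add_re, Complex.re_sum,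
    sub_mul, Finset.sum_sub_distrib, ← Finset.mul_sum]
  ring

lemma trace_conj {n : ℕ} (U : unitaryGroup (Fin n) ℂ) (M : Matrix (Fin n) (Fin n) ℂ) :
    (U.1 * M * U.1ᴴ).trace = M.trace := by
  have : U.1ᴴ * U.1 = 1 := mem_unitaryGroup_iff'.mp U.2
  rw [trace_mul_comm, ← mul_assoc, this, one_mul]

lemma integral_diagChar_minor {n : ℕ} (y : Fin n → ℝ) (M : Matrix (Fin (n + 1)) (Fin (n + 1)) ℂ) :
    ∫ U, diagChar y ((U.1 * M * U.1ᴴ).submatrix Fin.succ Fin.succ) ∂haarU (n + 1)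
      = ∫ U, orbitChar y ((U.1 * M * U.1ᴴ).submatrix Fin.succ Fin.succ) ∂haarU (n + 1) := by
  have hcont : Continuous fun q : unitaryGroup (Fin n) ℂ × unitaryGroup (Fin (n + 1)) ℂ =>
      diagChar y (q.1.1 * (q.2.1 * M * q.2.1ᴴ).submatrix Fin.succ Fin.succ * q.1.1ᴴ) :=
    (continuous_diagChar y).comp (by fun_prop)
  have hinv : ∀ V : unitaryGroup (Fin n) ℂ,
      ∫ U, diagChar y (V.1 * (U.1 * M * U.1ᴴ).submatrix Fin.succ Fin.succ * V.1ᴴ) ∂haarU (n + 1)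
      = ∫ U, diagChar y ((U.1 * M * U.1ᴴ).submatrix Fin.succ Fin.succ) ∂haarU (n + 1) := by
    intro V
    set W : unitaryGroup (Fin (n + 1)) ℂ := ⟨bordered V.1, mem_unitaryGroup_iff.mpr
      (bordered_mul_conjTranspose (mem_unitaryGroup_iff.mp V.2))⟩ with hW
    rw [← integral_mul_left_eq_self (fun U : unitaryGroup (Fin (n + 1)) ℂ =>
      diagChar y ((U.1 * M * U.1ᴴ).submatrix Fin.succ Fin.succ)) W]
    refine integral_congr_ae (.of_forall fun U => ?_)
    simp only
    rw [← submatrix_bordered_conj]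
    simp only [hW, Submonoid.coe_mul, conjTranspose_mul, mul_assoc]
  calc ∫ U, diagChar y ((U.1 * M * U.1ᴴ).submatrix Fin.succ Fin.succ) ∂haarU (n + 1)
      = ∫ V, (∫ U, diagChar y (V.1 * (U.1 * M * U.1ᴴ).submatrix Fin.succ Fin.succ * V.1ᴴ)
          ∂haarU (n + 1)) ∂haarU n := by simp_rw [hinv]; simp
    _ = ∫ U, (∫ V, diagChar y (V.1 * (U.1 * M * U.1ᴴ).submatrix Fin.succ Fin.succ * V.1ᴴ)
          ∂haarU n) ∂haarU (n + 1) := by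
        refine integral_integral_swap ?_
        exact hcont.integrable_of_hasCompactSupport (HasCompactSupport.of_compactSpace _)
    _ = _ := rfl

lemma orbitChar_diagonal_succ {n : ℕ} (x a : Fin (n + 1) → ℝ) :
    orbitChar x (diagonal fun i => (a i : ℂ))
      = Complex.exp (((x 0 * ∑ i, a i : ℝ) : ℂ) * Complex.I)
        * ∫ U, orbitChar (fun i => x i.succ - x 0)
          ((U.1 * (diagonal fun i => (a i : ℂ)) * U.1ᴴ).submatrix Fin.succ Fin.succ)
          ∂haarU (n + 1) := by
  rw [orbitChar, ← integral_diagChar_minor, ← integral_const_mul]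
  refine integral_congr_ae (.of_forall fun U => ?_)
  simp only
  rw [diagChar_succ, trace_conj, trace_diagonal, Complex.re_sum]
  simp only [Complex.ofReal_re]

lemma charpoly_minor_eval {n : ℕ} (U : unitaryGroup (Fin (n + 1)) ℂ) (a : Fin (n + 1) → ℂ) (z : ℂ) :
    ((U.1 * diagonal a * U.1ᴴ).submatrix Fin.succ Fin.succ).charpoly.eval z
      = ∑ k, (‖U.1 0 k‖ ^ 2 : ℂ) * ∏ j : Fin n, (z - a (k.succAbove j)) := by
  have hU : U.1 * U.1ᴴ = 1 := mem_unitaryGroup_iff.mp U.2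
  have hdet : U.1.det * U.1ᴴ.det = 1 := by rw [← det_mul, hU, det_one]
  have hadj : ∀ A B : Matrix (Fin (n + 1)) (Fin (n + 1)) ℂ, A * B = 1 →
      adjugate A = A.det • B := by
    intro A B h
    have h1 := adjugate_mul A
    calc adjugate A = adjugate A * (A * B) := by rw [h, mul_one]
      _ = A.det • B := by rw [← mul_assoc, h1, smul_mul, one_mul]
  have h1 : scalar (Fin (n + 1)) z - U.1 * diagonal a * U.1ᴴ
      = U.1 * (diagonal fun k => z - a k) * U.1ᴴ := by
    have : (diagonal fun k => z - a k) = scalar (Fin (n + 1)) z - diagonal a := by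
      rw [scalar_apply, diagonal_sub]
    rw [this, mul_sub, sub_mul, ← (scalar_commute z (Commute.all z) U.1).eq,
      mul_assoc (scalar (Fin (n + 1)) z), hU, mul_one]
  have h2 : adjugate (U.1 * (diagonal fun k => z - a k) * U.1ᴴ)
      = U.1 * adjugate (diagonal fun k => z - a k) * U.1ᴴ := by
    rw [adjugate_mul_distrib, adjugate_mul_distrib, hadj U.1 U.1ᴴ hU,
      hadj U.1ᴴ U.1 (mem_unitaryGroup_iff'.mp U.2), smul_mul, Matrix.mul_smul, Matrix.mul_smul,
      smul_smul,
      mul_comm U.1ᴴ.det, hdet, one_smul, mul_assoc]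
  rw [eval_charpoly]
  have h3 : scalar (Fin n) z - (U.1 * diagonal a * U.1ᴴ).submatrix Fin.succ Fin.succ
      = (scalar (Fin (n + 1)) z - U.1 * diagonal a * U.1ᴴ).submatrix
        (Fin.succAbove 0) (Fin.succAbove 0) := by
    ext i j
    simp [scalar_apply, diagonal_apply]
  have h4 := adjugate_fin_succ_eq_det_submatrix
    (scalar (Fin (n + 1)) z - U.1 * diagonal a * U.1ᴴ) 0 0
  simp only [Fin.val_zero, add_zero, pow_zero, one_mul] at h4
  rw [h3, ← h4, h1, h2, adjugate_diagonal, mul_apply]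
  refine Finset.sum_congr rfl fun k _ => ?_
  rw [mul_diagonal, conjTranspose_apply, ← Complex.mul_conj']
  have : ∏ j : Fin n, (z - a (k.succAbove j)) = ∏ l ∈ Finset.univ.erase k, (z - a l) := by
    rw [← Finset.prod_image (s := Finset.univ) (g := k.succAbove) (f := fun l => z - a l)
      Fin.succAbove_right_injective.injOn]
    congr 1
    ext l
    simp
  rw [this]
  simp only [Complex.star_def]
  ring

lemma ae_row_mem_posOrthant (n : ℕ) :
    ∀ᵐ U ∂haarU (n + 1), (fun k => ‖U.1 0 k‖ ^ 2) ∈ posOrthant (n + 1) := by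
  have hmem : ∀ r : ℝ, 0 < r → ∀ t : Fin (n + 1) → ℝ,
      r • t ∈ posOrthant (n + 1) ↔ t ∈ posOrthant (n + 1) := by
    intro r hr t
    simp [posOrthant, hr]
  have hrow : Measurable fun U : unitaryGroup (Fin (n + 1)) ℂ => fun k => ‖U.1 0 k‖ ^ 2 := by
    have : ∀ k : Fin (n + 1), Continuous fun U : unitaryGroup (Fin (n + 1)) ℂ => U.1 0 k :=
      fun k => continuous_subtype_val.matrix_elem 0 k
    exact (continuous_pi fun k => (this k).norm.pow 2).measurable
  set g : (Fin (n + 1) → ℝ) → ℂ := (posOrthant (n + 1))ᶜ.indicator 1 with hg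
  have h := integral_norm_sq_row (g := g)
    (measurable_const.indicator (measurableSet_posOrthant _).compl)
    (K := 1) (fun t => by rw [hg, Set.indicator]; split_ifs <;> simp)
    (fun r hr t => by
      by_cases ht : t ∈ posOrthant (n + 1)
      · simp [hg, ht, (hmem r hr t).mpr ht]
      · simp [hg, ht, mt (hmem r hr t).mp ht])
  rw [setIntegral_eq_zero_of_forall_eq_zero fun t ht => by simp [hg, ht]] at h
  have h2 : (fun U : unitaryGroup (Fin (n + 1)) ℂ => g fun k => ‖U.1 0 k‖ ^ 2)
      = ((fun U : unitaryGroup (Fin (n + 1)) ℂ => fun k => ‖U.1 0 k‖ ^ 2) ⁻¹'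
        (posOrthant (n + 1))ᶜ).indicator 1 := rfl
  rw [h2, integral_indicator (hrow (measurableSet_posOrthant _).compl)] at h
  simp only [Pi.one_apply, integral_const, measureReal_restrict_apply_univ, Complex.real_smul,
    mul_one] at h
  rw [ae_iff]
  exact (measureReal_eq_zero_iff).mp (Complex.ofReal_eq_zero.mp h)

lemma sum_norm_sq_row {n : ℕ} (U : unitaryGroup (Fin (n + 1)) ℂ) : ∑ k, ‖U.1 0 k‖ ^ 2 = 1 := by
  have h := congrFun (congrFun (mem_unitaryGroup_iff.mp U.2) 0) 0
  rw [mul_apply, one_apply_eq] at h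
  have h2 : ((∑ k, ‖U.1 0 k‖ ^ 2 : ℝ) : ℂ) = 1 := by
    rw [← h]
    simp [Complex.mul_conj']
  exact_mod_cast h2

lemma hasEigs_minor {n : ℕ} {α v : Fin (n + 1) → ℝ} (hα : StrictMono α)
    (U : unitaryGroup (Fin (n + 1)) ℂ) (h : residueMap α v = fun k => ‖U.1 0 k‖ ^ 2) :
    HasEigs ((U.1 * (diagonal fun i => (α i : ℂ)) * U.1ᴴ).submatrix Fin.succ Fin.succ)
      (fun j => v j.succ) := by
  have hv0 : v 0 = 1 := by rw [← sum_residueMap hα v, h, sum_norm_sq_row]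
  have hM : HasEigs (U.1 * (diagonal fun i => (α i : ℂ)) * U.1ᴴ) α :=
    ⟨U.1, mem_unitaryGroup_iff.mp U.2, mem_unitaryGroup_iff'.mp U.2, rfl⟩
  refine hasEigs_of_charpoly_eq (hM.isHermitian.submatrix _) ?_
  have hp := congrArg (Polynomial.map Complex.ofRealHom) (residuePoly_residueMap hα v)
  refine Polynomial.funext fun z => ?_
  rw [charpoly_minor_eval]
  have hz := congrArg (eval z) hp
  rw [h, hv0] at hz
  simp only [residuePoly, Polynomial.map_sum, Polynomial.map_mul, Polynomial.map_prod,
    Polynomial.map_sub, map_X, map_C, Complex.ofRealHom_eq_coe, map_one, one_mul, eval_prod,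
    eval_sub, eval_X, eval_C, eval_finsetSum, eval_mul, Complex.ofReal_pow] at hz
  simpa [eval_prod] using hz

lemma integral_orbitChar_minor {n : ℕ} (y : Fin n → ℝ) {α : Fin (n + 1) → ℝ} (hα : StrictMono α) :
    ∫ U, orbitChar y ((U.1 * (diagonal fun i => (α i : ℂ)) * U.1ᴴ).submatrix Fin.succ Fin.succ)
        ∂haarU (n + 1)
      = ∫ v in interlaceSet α, ((v 0 ^ n * (vandermonde fun j : Fin n => v j.succ).det
          / (vandermonde α).det : ℝ) : ℂ) * (((Real.exp (-v 0) : ℝ) : ℂ)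
          * orbitChar y (diagonal fun j => (v j.succ : ℂ))) := by
  have hcont : ContinuousOn (residueMap α) (interlaceSet α) := fun v _ =>
    (hasFDerivAt_residueMap α v).continuousAt.continuousWithinAt
  have hemb := hcont.measurableEmbedding (measurableSet_interlaceSet α) (injOn_residueMap hα)
  obtain ⟨g₀, hg₀m, hg₀⟩ := hemb.exists_measurable_extend
    (g := fun v : interlaceSet α => orbitChar y (diagonal fun j => (v.1 j.succ : ℂ)))
    (((continuous_orbitChar_diagonal y).measurable.comp (by fun_prop :
      Measurable fun v : Fin (n + 1) → ℝ => fun j : Fin n => v j.succ)).comp measurable_subtype_coe)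
    (fun _ => inferInstance)
  have hg₀v : ∀ v ∈ interlaceSet α,
      g₀ (residueMap α v) = orbitChar y (diagonal fun j => (v j.succ : ℂ)) :=
    fun v hv => congrFun hg₀ ⟨v, hv⟩
  set g := (posOrthant (n + 1)).indicator g₀ with hg
  have hgv : ∀ v ∈ interlaceSet α,
      g (residueMap α v) = orbitChar y (diagonal fun j => (v j.succ : ℂ)) := by
    intro v hv
    rw [hg, Set.indicator_of_mem, hg₀v v hv]
    rw [← image_residueMap hα]
    exact Set.mem_image_of_mem _ hv
  have hgm : Measurable g := hg₀m.indicator (measurableSet_posOrthant _)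
  have hgb : ∀ t, ‖g t‖ ≤ 1 := by
    intro t
    by_cases ht : t ∈ posOrthant (n + 1)
    · obtain ⟨v, hv, rfl⟩ := (image_residueMap hα).symm ▸ ht
      rw [hgv v hv]
      exact norm_orbitChar_le _ _
    · simp [hg, ht]
  have hgs : ∀ r : ℝ, 0 < r → ∀ t, g (r • t) = g t := by
    intro r hr t
    by_cases ht : t ∈ posOrthant (n + 1)
    · obtain ⟨v, hv, rfl⟩ := (image_residueMap hα).symm ▸ ht
      rw [← residueMap_smul, hgv v hv, hgv]
      · simp
      · rw [mem_interlaceSet] at hv ⊢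
        exact ⟨by simpa using mul_pos hr hv.1, by simpa using hv.2⟩
    · have ht' : r • t ∉ posOrthant (n + 1) := by simpa [posOrthant, hr] using ht
      simp [hg, ht, ht']
  have h1 : ∫ U, orbitChar y ((U.1 * (diagonal fun i => (α i : ℂ)) * U.1ᴴ).submatrix
      Fin.succ Fin.succ) ∂haarU (n + 1) = ∫ U, g (fun k => ‖U.1 0 k‖ ^ 2) ∂haarU (n + 1) := by
    refine integral_congr_ae ?_
    filter_upwards [ae_row_mem_posOrthant n] with U hU
    obtain ⟨v, hv, hvU⟩ := (image_residueMap hα).symm ▸ hU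
    rw [← hvU, hgv v hv]
    exact orbitChar_of_hasEigs y (hasEigs_minor hα U hvU)
  rw [h1, integral_norm_sq_row hgm hgb hgs, ← image_residueMap hα,
    integral_image_eq_integral_abs_det_fderiv_smul volume (measurableSet_interlaceSet α)
      (fun v _ => (hasFDerivAt_residueMap α v).hasFDerivWithinAt) (injOn_residueMap hα)]
  refine setIntegral_congr_fun (measurableSet_interlaceSet α) fun v hv => ?_
  have hdet : (toLin' (residueJacobian α v)).toContinuousLinearMap.det
      = (residueJacobian α v).det := by
    rw [ContinuousLinearMap.det, LinearMap.coe_toContinuousLinearMap, LinearMap.det_toLin']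
  rw [hdet, abs_det_residueJacobian hα hv, sum_residueMap hα, hgv v hv, Complex.real_smul]

lemma integral_interlaceSet_det {n : ℕ} {α : Fin (n + 1) → ℝ} {φ : ℝ → ℂ}
    (hφ : IntegrableOn φ (Set.Ioi 0)) {h : Fin n → ℝ → ℂ} (hh : ∀ i, Continuous (h i)) :
    ∫ v in interlaceSet α, φ (v 0) * (of fun i j => h i (v j.succ)).det
      = (∫ t in Set.Ioi 0, φ t) *
        (of fun i j => ∫ t in Set.Ioo (α j.castSucc) (α j.succ), h i t).det := by
  set I : Fin (n + 1) → Set ℝ :=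
    Fin.cons (Set.Ioi 0) fun j : Fin n => Set.Ioo (α j.castSucc) (α j.succ) with hI
  set f : Equiv.Perm (Fin n) → Fin (n + 1) → ℝ → ℂ := fun σ => Fin.cons φ fun j => h (σ j) with hf
  have hvol : volume.restrict (interlaceSet α)
      = Measure.pi fun i => (volume : Measure ℝ).restrict (I i) := by
    rw [interlaceSet, volume_pi, Measure.restrict_pi_pi]
  have hexp : ∀ v : Fin (n + 1) → ℝ, φ (v 0) * (of fun i j => h i (v j.succ)).det
      = ∑ σ : Equiv.Perm (Fin n), ((Equiv.Perm.sign σ : ℤ) : ℂ) * ∏ i, f σ i (v i) := by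
    intro v
    rw [det_apply', Finset.mul_sum]
    refine Finset.sum_congr rfl fun σ _ => ?_
    rw [Fin.prod_univ_succ]
    simp only [hf, Fin.cons_zero, Fin.cons_succ, of_apply]
    ring
  have hfint : ∀ σ, ∀ i, Integrable (f σ i) (volume.restrict (I i)) := by
    intro σ i
    refine Fin.cases ?_ (fun j => ?_) i
    · exact hφ
    · simp only [hf, hI, Fin.cons_succ]
      exact ((hh _).integrableOn_Icc).mono_set Set.Ioo_subset_Icc_self
  rw [hvol]
  simp_rw [hexp]
  rw [integral_finsetSum _ fun σ _ => (Integrable.fintype_prod (hfint σ)).const_mul _, det_apply',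
    Finset.mul_sum]
  refine Finset.sum_congr rfl fun σ _ => ?_
  rw [integral_const_mul, integral_fintype_prod_eq_prod, Fin.prod_univ_succ]
  simp only [hf, hI, Fin.cons_zero, Fin.cons_succ, of_apply]
  ring

lemma det_cons_const_eq_mul_det_sub {n : ℕ} (c : ℂ) (H : Fin n → Fin (n + 1) → ℂ) :
    (of (Fin.cons (fun _ => c) H : Fin (n + 1) → Fin (n + 1) → ℂ)).det
      = c * (of fun i (j : Fin n) => H i j.succ - H i j.castSucc).det := by
  set A : Matrix (Fin (n + 1)) (Fin (n + 1)) ℂ := of (Fin.cons (fun _ => c) H) with hA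
  have h := det_eq_of_forall_col_eq_smul_add_pred (A := A)
    (B := of fun i => Fin.cons (A i 0) fun j : Fin n => A i j.succ - A i j.castSucc)
    (fun _ => 1) (by simp) (by simp)
  rw [h, det_succ_row_zero, Fin.sum_univ_succ, Finset.sum_eq_zero]
  · simp only [hA, Fin.val_zero, pow_zero, one_mul, of_apply, Fin.cons_zero, add_zero]
    congr 1
  · intro j _
    simp [hA]

lemma exists_orbitChar_eq_det (n : ℕ) (x : Fin n → ℝ) :
    ∃ h : Fin n → ℝ → ℂ, (∀ i, Continuous (h i)) ∧ ∀ a : Fin n → ℝ, StrictMono a →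
      ((vandermonde a).det : ℂ) * orbitChar x (diagonal fun i => (a i : ℂ))
        = (of fun i j => h i (a j)).det := by
  induction n with
  | zero =>
    refine ⟨fun _ _ => 0, fun i => i.elim0, fun a _ => ?_⟩
    simp [orbitChar, diagChar]
  | succ n ih =>
    obtain ⟨h, hh, hdet⟩ := ih fun i => x i.succ - x 0
    set φ : ℝ → ℂ := fun t => ((t ^ n * Real.exp (-t) : ℝ) : ℂ) with hφ
    have hφi : IntegrableOn φ (Set.Ioi 0) := by
      have := Real.GammaIntegral_convergent (s := n + 1) (by positivity)
      have h' : IntegrableOn (fun t => t ^ n * Real.exp (-t)) (Set.Ioi 0) :=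
        this.congr_fun (fun t _ => by simp [mul_comm]) measurableSet_Ioi
      exact h'.ofReal
    set c : ℂ := ∫ t in Set.Ioi 0, φ t with hc
    set e : ℝ → ℂ := fun t => Complex.exp (((x 0 * t : ℝ) : ℂ) * Complex.I) with he
    have hec : Continuous e := by fun_prop
    refine ⟨fun i t => e t * (Fin.cons (fun _ => c) (fun j t => ∫ u in (0 : ℝ)..t, h j u) :
      Fin (n + 1) → ℝ → ℂ) i t, fun i => hec.mul ?_, fun a ha => ?_⟩
    · refine Fin.cases ?_ (fun j => ?_) i
      · exact continuous_const
      · exact intervalIntegral.continuous_primitive (fun _ _ => (hh j).intervalIntegrable _ _) 0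
    have hVa : ((vandermonde a).det : ℂ) ≠ 0 := by
      exact_mod_cast (det_vandermonde_pos ha).ne'
    have h1 : ∫ v in interlaceSet a, ((v 0 ^ n * (vandermonde fun j : Fin n => v j.succ).det
          / (vandermonde a).det : ℝ) : ℂ) * (((Real.exp (-v 0) : ℝ) : ℂ)
          * orbitChar (fun i => x i.succ - x 0) (diagonal fun j => (v j.succ : ℂ)))
        = ((vandermonde a).det : ℂ)⁻¹ *
          (c * (of fun i j => ∫ t in Set.Ioo (a j.castSucc) (a j.succ), h i t).det) := by
      rw [hc, ← integral_interlaceSet_det hφi hh, ← integral_const_mul]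
      refine setIntegral_congr_fun (measurableSet_interlaceSet a) fun v hv => ?_
      rw [← hdet _ (strictMono_of_mem_interlaceSet ha hv), hφ]
      push_cast
      field_simp
    have h2 : ∀ (i j : Fin n), ∫ t in Set.Ioo (a j.castSucc) (a j.succ), h i t
        = (∫ u in (0 : ℝ)..a j.succ, h i u) - ∫ u in (0 : ℝ)..a j.castSucc, h i u := by
      intro i j
      rw [intervalIntegral.integral_interval_sub_left ((hh i).intervalIntegrable _ _)
        ((hh i).intervalIntegrable _ _), intervalIntegral.integral_of_le
        (ha Fin.castSucc_lt_succ).le, integral_Ioc_eq_integral_Ioo]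
    rw [orbitChar_diagonal_succ, integral_orbitChar_minor _ ha, h1, mul_left_comm,
      mul_inv_cancel_left₀ hVa]
    simp_rw [h2]
    rw [← det_cons_const_eq_mul_det_sub c fun i j => ∫ u in (0 : ℝ)..a j, h i u]
    have h3 : Complex.exp (((x 0 * ∑ i, a i : ℝ) : ℂ) * Complex.I) = ∏ j, e (a j) := by
      rw [he, ← Complex.exp_sum]
      simp only [Finset.mul_sum, Complex.ofReal_sum, Finset.sum_mul]
    rw [h3, ← det_mul_row]
    congr 1
    ext i j
    refine Fin.cases ?_ (fun i => ?_) i <;> simp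

/-- The orbital integral of a unitary orbit, multiplied by the Vandermonde determinant of the
eigenvalues `a`, is a determinant whose `j`-th column depends on `a j` only. -/
theorem exists_orbitChar_eq_det_of_injective (n : ℕ) (x : Fin n → ℝ) :
    ∃ h : Fin n → ℝ → ℂ, ∀ a : Fin n → ℝ, Function.Injective a →
      ((vandermonde a).det : ℂ) * orbitChar x (diagonal fun i => (a i : ℂ))
        = (of fun i j => h i (a j)).det := by
  obtain ⟨h, -, hdet⟩ := exists_orbitChar_eq_det n x
  refine ⟨h, fun a ha => ?_⟩
  set σ := Tuple.sort a
  have hσ : StrictMono (a ∘ σ) := (Tuple.monotone_sort a).strictMono_of_injective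
    (ha.comp σ.injective)
  have h1 := hdet _ hσ
  have hV : (vandermonde (a ∘ σ)).det = Equiv.Perm.sign σ * (vandermonde a).det := by
    rw [← det_permute]
    rfl
  have hD : (of fun i j => h i ((a ∘ σ) j)).det
      = Equiv.Perm.sign σ * (of fun i j => h i (a j)).det := by
    rw [← det_permute']
    rfl
  have hF : orbitChar x (diagonal fun i => ((a ∘ σ) i : ℂ))
      = orbitChar x (diagonal fun i => (a i : ℂ)) :=
    (orbitChar_of_hasEigs x ((hasEigs_diagonal a).perm σ)).symm
  rw [hV, hD, hF] at h1
  push_cast at h1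
  rw [mul_assoc] at h1
  refine mul_left_cancel₀ ?_ h1
  exact_mod_cast (Equiv.Perm.sign σ).ne_zero

/-- The sign that is `1` on the left summand and `-1` on the right one. -/
def sideSign {ι : Type} : ι ⊕ ι → ℝ := Sum.elim (fun _ => 1) fun _ => -1

lemma det_fromBlocks_neg {ι : Type} [Fintype ι] [DecidableEq ι] (M N : Matrix ι ι ℂ) :
    (fromBlocks M N M (-N)).det = (-2) ^ Fintype.card ι * (M.det * N.det) := by
  have h : fromBlocks 1 0 (-1) 1 * fromBlocks M N M (-N)
      = fromBlocks M N 0 ((-2 : ℂ) • N) := by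
    rw [fromBlocks_multiply]
    congr 1 <;> simp
    rw [two_smul]
    abel
  have h' := congrArg det h
  rw [det_mul, det_fromBlocks_zero₁₂, det_fromBlocks_zero₂₁, det_smul] at h'
  simp only [det_one, one_mul] at h'
  rw [h']
  ring

lemma sum_perm_sign_mul_det_mul_det {ι : Type} [Fintype ι] [DecidableEq ι]
    (N : Matrix (ι ⊕ ι) (ι ⊕ ι) ℂ) :
    ∑ π : Equiv.Perm (ι ⊕ ι), ((Equiv.Perm.sign π : ℤ) : ℂ) *
      ((of fun i j => N (.inl i) (π (.inl j))).det * (of fun i j => N (.inr i) (π (.inr j))).det)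
      = ((Fintype.card ι).factorial : ℂ) ^ 2 * N.det := by
  have h : ∀ π : Equiv.Perm (ι ⊕ ι), ((Equiv.Perm.sign π : ℤ) : ℂ) *
      ((of fun i j => N (.inl i) (π (.inl j))).det * (of fun i j => N (.inr i) (π (.inr j))).det)
      = ∑ σ : Equiv.Perm ι, ∑ τ : Equiv.Perm ι,
        ((Equiv.Perm.sign (Equiv.Perm.sumCongr σ τ) : ℤ) : ℂ) *
          (((Equiv.Perm.sign π : ℤ) : ℂ) * ∏ c, N (Equiv.Perm.sumCongr σ τ c) (π c)) := by
    intro π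
    rw [det_apply', det_apply', Finset.sum_mul_sum, Finset.mul_sum]
    refine Finset.sum_congr rfl fun σ _ => ?_
    rw [Finset.mul_sum]
    refine Finset.sum_congr rfl fun τ _ => ?_
    rw [Fintype.prod_sum_type, Equiv.Perm.sign_sumCongr]
    simp only [of_apply, Equiv.Perm.sumCongr_apply, Sum.map_inl, Sum.map_inr]
    push_cast
    ring
  have hrow : ∀ ρ : Equiv.Perm (ι ⊕ ι), ∑ π : Equiv.Perm (ι ⊕ ι),
      ((Equiv.Perm.sign π : ℤ) : ℂ) * ∏ c, N (ρ c) (π c)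
        = ((Equiv.Perm.sign ρ : ℤ) : ℂ) * N.det := by
    intro ρ
    rw [← det_permute, ← det_transpose, det_apply']
    rfl
  simp_rw [h]
  rw [Finset.sum_comm]
  have hsq : ∀ ρ : Equiv.Perm (ι ⊕ ι),
      ((Equiv.Perm.sign ρ : ℤ) : ℂ) * (((Equiv.Perm.sign ρ : ℤ) : ℂ) * N.det) = N.det := by
    intro ρ
    rw [← mul_assoc, ← Int.cast_mul, ← Units.val_mul, Int.units_mul_self]
    simp
  calc _ = ∑ σ : Equiv.Perm ι, ∑ τ : Equiv.Perm ι, N.det := by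
        refine Finset.sum_congr rfl fun σ _ => ?_
        rw [Finset.sum_comm]
        refine Finset.sum_congr rfl fun τ _ => ?_
        rw [← Finset.mul_sum, hrow, hsq]
    _ = _ := by
        simp [Fintype.card_perm]
        ring

lemma sum_perm_sideSign_mul_det_mul_det {ι : Type} [Fintype ι] [DecidableEq ι]
    (G : ι → ι ⊕ ι → ℂ) :
    ∑ π : Equiv.Perm (ι ⊕ ι),
      (((Equiv.Perm.sign π : ℤ) : ℝ) * ∏ j, sideSign (π (.inr j)) : ℝ) *
      ((of fun i j => G i (π (.inl j))).det * (of fun i j => G i (π (.inr j))).det)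
      = ((Fintype.card ι).factorial : ℂ) ^ 2 * ((-2) ^ Fintype.card ι *
        ((of fun i j => G i (.inl j)).det * (of fun i j => G i (.inr j)).det)) := by
  rw [← det_fromBlocks_neg, ← sum_perm_sign_mul_det_mul_det]
  have hl : ∀ i c, fromBlocks (of fun i j => G i (.inl j)) (of fun i j => G i (.inr j))
      (of fun i j => G i (.inl j)) (-of fun i j => G i (.inr j)) (.inl i) c = G i c := by
    rintro i (j | j) <;> rfl
  have hr : ∀ i c, fromBlocks (of fun i j => G i (.inl j)) (of fun i j => G i (.inr j))
      (of fun i j => G i (.inl j)) (-of fun i j => G i (.inr j)) (.inr i) c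
        = (sideSign c : ℂ) * G i c := by
    rintro i (j | j) <;> simp [sideSign]
  refine Finset.sum_congr rfl fun π _ => ?_
  simp_rw [hl, hr]
  have := det_mul_row (fun j => (sideSign (π (.inr j)) : ℂ)) (of fun i j => G i (π (.inr j)))
  simp only [of_apply] at this
  rw [this]
  push_cast
  ring

/-- The coefficient of the pair of spectra `g ∘ π ∘ inl`, `g ∘ π ∘ inr`. -/
noncomputable def splitCoeff {p : ℕ} (g : Fin p ⊕ Fin p → ℝ) (π : Equiv.Perm (Fin p ⊕ Fin p)) : ℝ :=
  ((Equiv.Perm.sign π : ℤ) : ℝ) * (∏ j, sideSign (π (.inr j))) *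
    ((vandermonde fun j => g (π (.inl j))).det * (vandermonde fun j => g (π (.inr j))).det)

lemma det_vandermonde_eq_prod_ite {m : ℕ} (v : Fin m → ℝ) :
    (vandermonde v).det = ∏ i, ∏ j, if i < j then v j - v i else 1 := by
  rw [det_vandermonde]
  refine Finset.prod_congr rfl fun i _ => ?_
  rw [← Finset.prod_filter]
  congr 1
  ext
  simp

lemma det_vandermonde_sum {p : ℕ} (f : Fin p ⊕ Fin p → ℝ) :
    (vandermonde (f ∘ finSumFinEquiv.symm)).det
      = (vandermonde fun j => f (.inl j)).det * (vandermonde fun j => f (.inr j)).det *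
        ∏ j, ∏ i, (f (.inr j) - f (.inl i)) := by
  have h1 : ∀ i j : Fin p, Fin.castAdd p i < Fin.natAdd p j := fun i j => by
    simp only [Fin.lt_def, Fin.val_castAdd, Fin.val_natAdd]
    omega
  have h2 : ∀ i j : Fin p, ¬ Fin.natAdd p j < Fin.castAdd p i := fun i j => (h1 i j).not_gt
  have h3 : ∀ i j : Fin p, Fin.castAdd p i < Fin.castAdd p j ↔ i < j := fun i j => Iff.rfl
  have h4 : ∀ i j : Fin p, Fin.natAdd p i < Fin.natAdd p j ↔ i < j := fun i j => by
    simp only [Fin.lt_def, Fin.val_natAdd, add_lt_add_iff_left]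
  simp only [det_vandermonde_eq_prod_ite]
  rw [← Equiv.prod_comp finSumFinEquiv, Fintype.prod_sum_type]
  simp only [← Equiv.prod_comp (finSumFinEquiv (m := p) (n := p)), Fintype.prod_sum_type,
    Function.comp_apply, Equiv.symm_apply_apply, finSumFinEquiv_apply_left,
    finSumFinEquiv_apply_right, finSumFinEquiv_symm_apply_castAdd,
    finSumFinEquiv_symm_apply_natAdd, h1, h2, h3, h4, if_true, if_false, Finset.prod_const_one,
    one_mul]
  rw [Finset.prod_mul_distrib, Finset.prod_comm (f := fun j i => f (.inr j) - f (.inl i))]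
  ring

lemma det_vandermonde_sum_perm {p : ℕ} (f : Fin p ⊕ Fin p → ℝ) (π : Equiv.Perm (Fin p ⊕ Fin p)) :
    (vandermonde ((f ∘ π) ∘ finSumFinEquiv.symm)).det
      = ((Equiv.Perm.sign π : ℤ) : ℝ) * (vandermonde (f ∘ finSumFinEquiv.symm)).det := by
  have h := det_permute (finSumFinEquiv.permCongr π) (vandermonde (f ∘ finSumFinEquiv.symm))
  rw [Equiv.Perm.sign_permCongr] at h
  rw [← h]
  congr 1
  ext i j
  simp [vandermonde_apply]

lemma prod_ite_sub_eq {p : ℕ} (b : Fin p → ℝ) :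
    ∏ j, ∏ l, (if l = j then 1 else b j - b l)
      = (∏ j : Fin p, ∏ l, if j < l then -1 else 1) * (vandermonde b).det ^ 2 := by
  have h := prod_erase_eq_prod_Ioi_sq (fun k l : Fin p => if k < l then b l - b k else b k - b l) ?_
  · have h2 : (∏ k : Fin p, ∏ l ∈ Finset.Ioi k, if k < l then b l - b k else b k - b l)
        = (vandermonde b).det := by
      rw [det_vandermonde]
      refine Finset.prod_congr rfl fun k _ => Finset.prod_congr rfl fun l hl => ?_
      rw [if_pos (Finset.mem_Ioi.1 hl)]
    rw [h2] at h
    rw [← h, ← Finset.prod_mul_distrib]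
    refine Finset.prod_congr rfl fun k _ => ?_
    rw [← Finset.mul_prod_erase _ _ (Finset.mem_univ k),
      ← Finset.mul_prod_erase _ (fun l => if k < l then (-1 : ℝ) else 1) (Finset.mem_univ k)]
    simp only [if_true, lt_irrefl, if_false, one_mul]
    rw [← Finset.prod_mul_distrib]
    refine Finset.prod_congr rfl fun l hl => ?_
    rw [if_neg (Finset.ne_of_mem_erase hl)]
    split_ifs <;> ring
  · intro k l
    rcases lt_trichotomy k l with h | h | h
    · simp [h, h.not_gt]
    · simp [h]
    · simp [h, h.not_gt]

lemma sideSign_mul_prod_pos {p : ℕ} {g : Fin p ⊕ Fin p → ℝ}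
    (hpair : ∀ k, g (.inr k) < g (.inl k)) (hlt : ∀ i k, i < k → g (.inl k) < g (.inr i))
    (c : Fin p ⊕ Fin p) : 0 < sideSign c * ∏ c', (if c' = c then 1 else g c - g c') := by
  rw [Fintype.prod_sum_type, ← Finset.prod_mul_distrib]
  obtain k | k := c
  · rw [← Finset.mul_prod_erase _ _ (Finset.mem_univ k), ← mul_assoc]
    refine mul_pos (by simpa [sideSign] using hpair k) (Finset.prod_pos fun i hi => ?_)
    rw [if_neg (by simpa using Finset.ne_of_mem_erase hi), if_neg (by simp)]
    rcases (Finset.ne_of_mem_erase hi).lt_or_gt with h | h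
    · nlinarith [hlt i k h, hpair i, hpair k]
    · nlinarith [hlt k i h, hpair i, hpair k]
  · rw [← Finset.mul_prod_erase _ _ (Finset.mem_univ k), ← mul_assoc]
    refine mul_pos (by simpa [sideSign] using hpair k) (Finset.prod_pos fun i hi => ?_)
    rw [if_neg (by simp), if_neg (by simpa using Finset.ne_of_mem_erase hi)]
    rcases (Finset.ne_of_mem_erase hi).lt_or_gt with h | h
    · nlinarith [hlt i k h, hpair i, hpair k]
    · nlinarith [hlt k i h, hpair i, hpair k]

lemma exists_mul_splitCoeff_pos {p : ℕ} {g : Fin p ⊕ Fin p → ℝ} (hg : Function.Injective g)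
    (hpair : ∀ k, g (.inr k) < g (.inl k)) (hlt : ∀ i k, i < k → g (.inl k) < g (.inr i)) :
    ∃ K : ℝ, ∀ π, 0 < K * splitCoeff g π := by
  refine ⟨(∏ j : Fin p, ∏ l, if j < l then -1 else 1) *
    (vandermonde (g ∘ finSumFinEquiv.symm)).det, fun π => ?_⟩
  set b : Fin p → ℝ := fun j => g (π (.inr j)) with hb
  set a : Fin p → ℝ := fun j => g (π (.inl j)) with ha
  set e : ℝ := ∏ j : Fin p, ∏ l, if j < l then -1 else 1 with he
  set D : ℝ := ∏ j, ∏ i, (b j - a i) with hD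
  set d : ℝ := ∏ j, sideSign (π (.inr j)) with hd
  have hVa : (vandermonde a).det ≠ 0 := det_vandermonde_ne_zero_iff.2 fun i j h => by
    simpa using hg h
  have hT := det_vandermonde_sum (g ∘ π)
  rw [det_vandermonde_sum_perm] at hT
  change _ = (vandermonde a).det * (vandermonde b).det * D at hT
  have hpos : 0 < d * (D * (e * (vandermonde b).det ^ 2)) := by
    rw [← prod_ite_sub_eq, hD, hd, ← Finset.prod_mul_distrib, ← Finset.prod_mul_distrib]
    refine Finset.prod_pos fun j _ => ?_
    have := sideSign_mul_prod_pos hpair hlt (π (.inr j))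
    rw [← Equiv.prod_comp π, Fintype.prod_sum_type] at this
    simpa using this
  have heq : e * (vandermonde (g ∘ finSumFinEquiv.symm)).det * splitCoeff g π
      = (vandermonde a).det ^ 2 * (d * (D * (e * (vandermonde b).det ^ 2))) := by
    change _ * (_ * d * ((vandermonde a).det * (vandermonde b).det)) = _
    linear_combination e * d * (vandermonde a).det * (vandermonde b).det * hT
  rw [heq]
  positivity

theorem sum_splitCoeff_mul_orbitChar {p : ℕ} {g : Fin p ⊕ Fin p → ℝ} (hg : Function.Injective g)
    (x : Fin p → ℝ) :
    ∑ π : Equiv.Perm (Fin p ⊕ Fin p), (splitCoeff g π : ℂ) *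
      (orbitChar x (diagonal fun i => (g (π (.inl i)) : ℂ))
        * orbitChar x (diagonal fun i => (g (π (.inr i)) : ℂ)))
      = (((p.factorial : ℝ) ^ 2 * 2 ^ p * splitCoeff g 1 : ℝ) : ℂ) *
        (orbitChar x (diagonal fun i => (g (.inl i) : ℂ))
          * orbitChar x (diagonal fun i => (g (.inr i) : ℂ))) := by
  obtain ⟨h, hdet⟩ := exists_orbitChar_eq_det_of_injective p x
  have hl : ∀ π : Equiv.Perm (Fin p ⊕ Fin p), Function.Injective fun j => g (π (.inl j)) :=
    fun π => hg.comp (π.injective.comp Sum.inl_injective)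
  have hr : ∀ π : Equiv.Perm (Fin p ⊕ Fin p), Function.Injective fun j => g (π (.inr j)) :=
    fun π => hg.comp (π.injective.comp Sum.inr_injective)
  have key := sum_perm_sideSign_mul_det_mul_det (ι := Fin p) fun i c => h i (g c)
  have h1 := hdet _ (hl 1)
  have h2 := hdet _ (hr 1)
  simp only [Equiv.Perm.coe_one, id_eq] at h1 h2
  rw [← h1, ← h2, Fintype.card_fin] at key
  have hsum : ∀ π : Equiv.Perm (Fin p ⊕ Fin p), (splitCoeff g π : ℂ) *
      (orbitChar x (diagonal fun i => (g (π (.inl i)) : ℂ))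
        * orbitChar x (diagonal fun i => (g (π (.inr i)) : ℂ)))
      = ((((Equiv.Perm.sign π : ℤ) : ℝ) * ∏ j, sideSign (π (.inr j)) : ℝ) : ℂ) *
        ((of fun i j => h i (g (π (.inl j)))).det * (of fun i j => h i (g (π (.inr j)))).det) := by
    intro π
    rw [← hdet _ (hl π), ← hdet _ (hr π), splitCoeff]
    push_cast
    ring
  rw [Finset.sum_congr rfl fun π _ => hsum π, key]
  simp only [splitCoeff, sideSign, Equiv.Perm.coe_one, id_eq, Sum.elim_inr, Equiv.Perm.sign_one,
    Finset.prod_const, Finset.card_univ, Fintype.card_fin]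
  rw [show (-2 : ℂ) = 2 * -1 by norm_num, mul_pow]
  push_cast
  ring

lemma exists_diag_repr {p : ℕ} (L : (Fin p → Fin p → ℂ) →L[ℝ] ℝ) :
    ∃ (x : Fin p → ℝ) (W : unitaryGroup (Fin p) ℂ), ∀ M : Matrix (Fin p) (Fin p) ℂ,
      M.IsHermitian → (L fun i j => M i j) = ∑ k, x k * ((W.1 * M * W.1ᴴ) k k).re := by
  set Y : Matrix (Fin p) (Fin p) ℂ := of fun l k =>
    (L (Pi.single k (Pi.single l 1)) : ℂ) - L (Pi.single k (Pi.single l Complex.I)) * Complex.I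
    with hY
  have hL : ∀ M : Matrix (Fin p) (Fin p) ℂ, (L fun i j => M i j) = (Y * M).trace.re := by
    intro M
    have hM : (fun i j => M i j) = ∑ k, ∑ l,
        ((M k l).re • (Pi.single k (Pi.single l 1) : Fin p → Fin p → ℂ)
          + (M k l).im • (Pi.single k (Pi.single l Complex.I) : Fin p → Fin p → ℂ)) := by
      ext k l
      simp only [Finset.sum_apply, Pi.add_apply, Pi.smul_apply, Pi.single_apply]
      rw [Finset.sum_eq_single k (by intro b _ hb; simp [hb.symm]) (by simp),
        Finset.sum_eq_single l (by intro b _ hb; simp [hb.symm]) (by simp)]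
      simp [Complex.re_add_im]
    conv_lhs => rw [hM]
    simp only [map_sum, map_add, map_smul, smul_eq_mul]
    simp only [trace, diag_apply, mul_apply, Complex.re_sum]
    rw [Finset.sum_comm]
    refine Finset.sum_congr rfl fun l _ => Finset.sum_congr rfl fun k _ => ?_
    simp [hY]
    ring
  set X : Matrix (Fin p) (Fin p) ℂ := (2⁻¹ : ℝ) • (Y + Yᴴ) with hX
  have hXh : X.IsHermitian := by
    rw [IsHermitian, hX, conjTranspose_smul, conjTranspose_add, conjTranspose_conjTranspose,
      add_comm]
    simp
  obtain ⟨x, U, h1, h2, hU⟩ : ∃ x, HasEigs X x := ⟨_, hXh.hasEigs⟩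
  refine ⟨x, ⟨Uᴴ, mem_unitaryGroup_iff.2 (by simpa [star_eq_conjTranspose] using h2)⟩,
    fun M hM => ?_⟩
  have hLX : (L fun i j => M i j) = (X * M).trace.re := by
    have : (Yᴴ * M).trace.re = (Y * M).trace.re := by
      rw [← trace_mul_comm, ← hM.eq, ← conjTranspose_mul, trace_conjTranspose, hM.eq]
      simp
    rw [hL, hX, smul_mul, add_mul, trace_smul, trace_add, Complex.smul_re, Complex.add_re, this,
      smul_eq_mul]
    ring
  rw [hLX, hU, mul_assoc, mul_assoc, trace_mul_comm]
  simp only [conjTranspose_conjTranspose, trace, diag_apply, mul_assoc, diagonal_mul,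
    Complex.re_sum, Complex.re_ofReal_mul]

/-- The sum `U a Uᴴ + V b Vᴴ`, for real diagonal matrices `a` and `b`. -/
noncomputable def orbitSum {p : ℕ} (a b : Fin p → ℝ)
    (w : unitaryGroup (Fin p) ℂ × unitaryGroup (Fin p) ℂ) : Matrix (Fin p) (Fin p) ℂ :=
  w.1.1 * diagonal (fun i => (a i : ℂ)) * w.1.1ᴴ + w.2.1 * diagonal (fun i => (b i : ℂ)) * w.2.1ᴴ

lemma continuous_orbitSum {p : ℕ} (a b : Fin p → ℝ) : Continuous (orbitSum a b) := by
  unfold orbitSum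
  fun_prop

/-- The law of the sum of two independent Hermitian matrices uniformly distributed on the unitary
orbits of the diagonal matrices with entries `a` and `b`. -/
noncomputable def orbitSumLaw {p : ℕ} (a b : Fin p → ℝ) : Measure (Fin p → Fin p → ℂ) :=
  ((haarU p).prod (haarU p)).map fun w i j => orbitSum a b w i j

lemma continuous_orbitSum_entries {p : ℕ} (a b : Fin p → ℝ) :
    Continuous fun w i j => orbitSum a b w i j :=
  continuous_pi fun i => continuous_pi fun j => (continuous_orbitSum a b).matrix_elem i j

instance {p : ℕ} (a b : Fin p → ℝ) : IsProbabilityMeasure (orbitSumLaw a b) :=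
  Measure.isProbabilityMeasure_map (continuous_orbitSum_entries a b).measurable.aemeasurable

lemma integral_diagChar_conj {p : ℕ} (x : Fin p → ℝ) (W : unitaryGroup (Fin p) ℂ)
    (M : Matrix (Fin p) (Fin p) ℂ) :
    ∫ U, diagChar x (W.1 * (U.1 * M * U.1ᴴ) * W.1ᴴ) ∂haarU p = orbitChar x M := by
  rw [orbitChar, ← integral_mul_left_eq_self (fun U : unitaryGroup (Fin p) ℂ =>
    diagChar x (U.1 * M * U.1ᴴ)) W]
  refine integral_congr_ae (.of_forall fun U => ?_)
  simp only [Submonoid.coe_mul, conjTranspose_mul, mul_assoc]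

lemma diagChar_add {p : ℕ} (x : Fin p → ℝ) (M N : Matrix (Fin p) (Fin p) ℂ) :
    diagChar x (M + N) = diagChar x M * diagChar x N := by
  rw [diagChar, diagChar, diagChar, ← Complex.exp_add, ← add_mul, ← Complex.ofReal_add,
    ← Finset.sum_add_distrib]
  simp only [Matrix.add_apply, Complex.add_re, mul_add]

lemma exists_charFunDual_orbitSumLaw {p : ℕ} (L : (Fin p → Fin p → ℂ) →L[ℝ] ℝ) :
    ∃ x : Fin p → ℝ, ∀ a b : Fin p → ℝ, charFunDual (orbitSumLaw a b) L
      = orbitChar x (diagonal fun i => (a i : ℂ)) * orbitChar x (diagonal fun i => (b i : ℂ)) := by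
  obtain ⟨x, W, hL⟩ := exists_diag_repr L
  refine ⟨x, fun a b => ?_⟩
  have hH : ∀ (a : Fin p → ℝ) (U : unitaryGroup (Fin p) ℂ),
      (U.1 * diagonal (fun i => (a i : ℂ)) * U.1ᴴ).IsHermitian := fun a U =>
    HasEigs.isHermitian ⟨U.1, mem_unitaryGroup_iff.1 U.2, mem_unitaryGroup_iff'.1 U.2, rfl⟩
  rw [charFunDual_apply, orbitSumLaw,
    integral_map (continuous_orbitSum_entries a b).measurable.aemeasurable
    (Continuous.aestronglyMeasurable (by fun_prop)), ← integral_diagChar_conj x W,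
    ← integral_diagChar_conj x W, ← integral_prod_mul]
  refine integral_congr_ae (.of_forall fun w => ?_)
  dsimp only
  rw [hL (orbitSum a b w) ((hH a w.1).add (hH b w.2)), ← diagChar_add, ← add_mul, ← mul_add]
  rfl

theorem exists_orbitSum_eq_of_interlacing {p : ℕ} {g : Fin p ⊕ Fin p → ℝ}
    (hg : Function.Injective g)
    (hpair : ∀ k, g (.inr k) < g (.inl k)) (hlt : ∀ i k, i < k → g (.inl k) < g (.inr i))
    (π : Equiv.Perm (Fin p ⊕ Fin p)) (w : unitaryGroup (Fin p) ℂ × unitaryGroup (Fin p) ℂ) :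
    ∃ w', orbitSum (fun i => g (.inl i)) (fun i => g (.inr i)) w'
      = orbitSum (fun i => g (π (.inl i))) (fun i => g (π (.inr i))) w := by
  obtain ⟨K, hK⟩ := exists_mul_splitCoeff_pos hg hpair hlt
  set ν : Equiv.Perm (Fin p ⊕ Fin p) → Measure (Fin p → Fin p → ℂ) := fun π =>
    orbitSumLaw (fun i => g (π (.inl i))) (fun i => g (π (.inr i))) with hν
  set c : ℝ := K * ((p.factorial : ℝ) ^ 2 * 2 ^ p * splitCoeff g 1) with hc
  have hc0 : 0 ≤ c := by
    have := (hK 1).le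
    rw [hc, mul_left_comm]
    positivity
  have hmeas : ∑ π, (K * splitCoeff g π).toNNReal • ν π = c.toNNReal • ν 1 := by
    refine Measure.ext_of_charFunDual (funext fun L => ?_)
    obtain ⟨x, hx⟩ := exists_charFunDual_orbitSumLaw L
    rw [charFunDual_apply, charFunDual_apply, integral_finsetSum_measure,
      integral_smul_nnreal_measure]
    · simp only [integral_smul_nnreal_measure, ← charFunDual_apply, hν, hx, NNReal.smul_def,
        Real.coe_toNNReal _ (hK _).le, Real.coe_toNNReal _ hc0, Complex.real_smul,
        Equiv.Perm.coe_one, id_eq]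
      rw [hc, Complex.ofReal_mul, mul_assoc, ← sum_splitCoeff_mul_orbitChar hg x, Finset.mul_sum]
      exact Finset.sum_congr rfl fun π _ => by push_cast; ring
    · intro π _
      refine Integrable.of_bound (Continuous.aestronglyMeasurable (by fun_prop)) 1
        (.of_forall fun v => (Complex.norm_exp_ofReal_mul_I _).le)
  set F := fun (w : unitaryGroup (Fin p) ℂ × unitaryGroup (Fin p) ℂ) i j =>
    orbitSum (fun i => g (.inl i)) (fun i => g (.inr i)) w i j with hF
  have hSc : IsClosed (Set.range F) :=
    (isCompact_range (continuous_orbitSum_entries _ _)).isClosed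
  have h1 : ν 1 (Set.range F)ᶜ = 0 := by
    have : F ⁻¹' (Set.range F)ᶜ = ∅ := by
      ext w
      simp
    change (Measure.map F _) _ = 0
    rw [Measure.map_apply (continuous_orbitSum_entries _ _).measurable hSc.measurableSet.compl,
      this, measure_empty]
  have h2 : ν π (Set.range F)ᶜ = 0 := by
    have h := congrArg (fun m : Measure _ => m (Set.range F)ᶜ) hmeas
    simp only [Measure.coe_finsetSum, Finset.sum_apply, Measure.smul_apply, h1, smul_zero,
      Finset.sum_eq_zero_iff, Finset.mem_univ, true_imp_iff] at h
    exact (smul_eq_zero.1 (h π)).resolve_left (Real.toNNReal_pos.2 (hK π)).ne'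
  by_contra hw
  have hmem : (fun i j => orbitSum (fun i => g (π (.inl i))) (fun i => g (π (.inr i))) w i j)
      ∈ (Set.range F)ᶜ := by
    rintro ⟨w', hw'⟩
    exact hw ⟨w', hw'⟩
  refine (hSc.isOpen_compl.preimage (continuous_orbitSum_entries _ _)).measure_ne_zero
    ((haarU p).prod (haarU p)) ⟨w, hmem⟩ ?_
  change Measure.map _ _ _ = 0 at h2
  rwa [Measure.map_apply (continuous_orbitSum_entries _ _).measurable
    hSc.measurableSet.compl] at h2

lemma injective_of_interlacing {p : ℕ} {g : Fin p ⊕ Fin p → ℝ}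
    (hpair : ∀ k, g (.inr k) < g (.inl k)) (hlt : ∀ i k, i < k → g (.inl k) < g (.inr i)) :
    Function.Injective g := by
  have hll : ∀ i k, i < k → g (.inl k) < g (.inl i) := fun i k h => (hlt i k h).trans (hpair i)
  have hrr : ∀ i k, i < k → g (.inr k) < g (.inr i) := fun i k h => (hpair k).trans (hlt i k h)
  have hlr : ∀ i k, g (.inl i) ≠ g (.inr k) := by
    intro i k
    rcases lt_trichotomy i k with h | h | h
    · exact ((hrr i k h).trans (hpair i)).ne'
    · exact h ▸ (hpair i).ne'
    · exact (hlt k i h).ne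
  rintro (i | i) (k | k) h
  · rcases lt_trichotomy i k with h' | h' | h'
    · exact absurd h (hll i k h').ne'
    · rw [h']
    · exact absurd h (hll k i h').ne
  · exact absurd h (hlr i k)
  · exact absurd h.symm (hlr k i)
  · rcases lt_trichotomy i k with h' | h' | h'
    · exact absurd h (hrr i k h').ne'
    · rw [h']
    · exact absurd h (hrr k i h').ne

theorem exists_orbitSum_eq_of_weakly_interlacing {p : ℕ} {g : Fin p ⊕ Fin p → ℝ}
    (hpair : ∀ k, g (.inr k) ≤ g (.inl k)) (hlt : ∀ i k, i < k → g (.inl k) ≤ g (.inr i))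
    (π : Equiv.Perm (Fin p ⊕ Fin p)) (w : unitaryGroup (Fin p) ℂ × unitaryGroup (Fin p) ℂ) :
    ∃ w', orbitSum (fun i => g (.inl i)) (fun i => g (.inr i)) w'
      = orbitSum (fun i => g (π (.inl i))) (fun i => g (π (.inr i))) w := by
  set r : Fin p ⊕ Fin p → ℝ :=
    Sum.elim (fun k : Fin p => 2 * (k : ℝ)) (fun k : Fin p => 2 * (k : ℝ) + 1) with hr
  set G : ℝ → Fin p ⊕ Fin p → ℝ := fun ε c => g c - ε * r c with hG
  have hT2 : T2Space (Matrix (Fin p) (Fin p) ℂ) := inferInstanceAs (T2Space (Fin p → Fin p → ℂ))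
  set S : Set (ℝ × (unitaryGroup (Fin p) ℂ × unitaryGroup (Fin p) ℂ)) :=
    {q | orbitSum (fun i => G q.1 (.inl i)) (fun i => G q.1 (.inr i)) q.2
        = orbitSum (fun i => G q.1 (π (.inl i))) (fun i => G q.1 (π (.inr i))) w} with hS
  have hcl : IsClosed S := by
    refine isClosed_eq ?_ ?_ <;>
    · unfold orbitSum
      fun_prop
  have himg := isClosedMap_fst_of_compactSpace _ hcl
  have hsub : Set.Ioi (0 : ℝ) ⊆ Prod.fst '' S := by
    intro ε hε
    have hε : 0 < ε := hε
    have hp : ∀ k, G ε (.inr k) < G ε (.inl k) := fun k => by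
      simp only [hG, hr, Sum.elim_inl, Sum.elim_inr]
      nlinarith [hpair k]
    have hl : ∀ i k, i < k → G ε (.inl k) < G ε (.inr i) := fun i k hik => by
      simp only [hG, hr, Sum.elim_inl, Sum.elim_inr]
      have : (i : ℝ) + 1 ≤ k := by exact_mod_cast hik
      nlinarith [hlt i k hik]
    obtain ⟨w', hw'⟩ := exists_orbitSum_eq_of_interlacing (injective_of_interlacing hp hl) hp hl π w
    exact ⟨(ε, w'), hw', rfl⟩
  have h0 : (0 : ℝ) ∈ closure (Set.Ioi (0 : ℝ)) := by simp
  obtain ⟨⟨ε, w'⟩, hw', rfl⟩ := himg.closure_subset_iff.2 hsub h0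
  exact ⟨w', by simpa [hS, hG] using hw'⟩

lemma hasEigs_iff_exists_unitaryGroup {p : ℕ} {M : Matrix (Fin p) (Fin p) ℂ} {a : Fin p → ℝ} :
    HasEigs M a ↔ ∃ U : unitaryGroup (Fin p) ℂ,
      M = U.1 * diagonal (fun i => (a i : ℂ)) * U.1ᴴ :=
  ⟨fun ⟨U, h1, _, h⟩ => ⟨⟨U, mem_unitaryGroup_iff.2 h1⟩, h⟩,
    fun ⟨U, h⟩ => ⟨U.1, mem_unitaryGroup_iff.1 U.2, mem_unitaryGroup_iff'.1 U.2, h⟩⟩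

lemma HasEigs.fromBlocks {ι : Type} [Fintype ι] [DecidableEq ι] {A B : Matrix ι ι ℂ} {a b : ι → ℝ}
    (hA : HasEigs A a) (hB : HasEigs B b) : HasEigs (fromBlocks A 0 0 B) (Sum.elim a b) := by
  obtain ⟨U, h1, h2, rfl⟩ := hA
  obtain ⟨V, h3, h4, rfl⟩ := hB
  have hd : diagonal (fun c => ((Sum.elim a b c : ℝ) : ℂ))
      = Matrix.fromBlocks (diagonal fun i => (a i : ℂ)) 0 0 (diagonal fun i => (b i : ℂ)) := by
    rw [fromBlocks_diagonal]
    congr 1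
    ext (i | i) <;> rfl
  refine ⟨Matrix.fromBlocks U 0 0 V, ?_, ?_, ?_⟩
  · simp [fromBlocks_conjTranspose, fromBlocks_multiply, h1, h3]
  · simp [fromBlocks_conjTranspose, fromBlocks_multiply, h2, h4]
  · rw [hd, fromBlocks_conjTranspose, fromBlocks_multiply, fromBlocks_multiply]
    simp

lemma HasEigs.exists_perm_of_fromBlocks {ι : Type} [Fintype ι] [DecidableEq ι]
    {A B : Matrix ι ι ℂ} {μ : ι ⊕ ι → ℝ} (h : HasEigs (Matrix.fromBlocks A 0 0 B) μ) :
    ∃ π : Equiv.Perm (ι ⊕ ι),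
      HasEigs A (fun i => μ (π (.inl i))) ∧ HasEigs B (fun i => μ (π (.inr i))) := by
  obtain ⟨hA, -, -, hB⟩ := isHermitian_fromBlocks_iff.1 h.isHermitian
  have h' := hA.hasEigs.fromBlocks hB.hasEigs
  obtain ⟨π, hπ⟩ := exists_perm_of_prod_X_sub_C_eq (h.charpoly_eq.symm.trans h'.charpoly_eq)
  refine ⟨π, ?_, ?_⟩
  · convert hA.hasEigs using 2 with i
    exact (congrFun hπ (.inl i)).symm
  · convert hB.hasEigs using 2 with i
    exact (congrFun hπ (.inr i)).symm

/-- The bijection matching the decomposition of an ordered list of length `2 p` into odd and even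
positions with its decomposition into halves. -/
def oddEvenEquiv (p : ℕ) : Fin p ⊕ Fin p ≃ Fin (p + p) where
  toFun := Sum.elim (fun i => ⟨2 * i, by omega⟩) fun i => ⟨2 * i + 1, by omega⟩
  invFun j := if j.1 % 2 = 0 then .inl ⟨j / 2, by omega⟩ else .inr ⟨j / 2, by omega⟩
  left_inv := by
    rintro (i | i)
    · simp
    · have : (2 * i.1 + 1) / 2 = i := by omega
      simp [this]
  right_inv j := by
    ext
    dsimp only
    split_ifs with h <;> simp <;> omega

theorem stmt4 (p : ℕ) (hp : 0 < p) (γ s : ℕ → ℝ)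
    (hγmono : ∀ a b, 1 ≤ a → a ≤ b → b ≤ 2 * p → γ b ≤ γ a)
    (hγnn : ∀ a, 1 ≤ a → a ≤ 2 * p → 0 ≤ γ a)
    (hsmono : ∀ a b, 1 ≤ a → a ≤ b → b ≤ p → s b ≤ s a)
    (hsnn : ∀ a, 1 ≤ a → a ≤ p → 0 ≤ s a) :
    (∃ A B C : Matrix (Fin p) (Fin p) ℂ,
        HasEigs A (fun i => γ (2 * (i : ℕ) + 1)) ∧
        HasEigs B (fun i => γ (2 * (i : ℕ) + 2)) ∧
        HasEigs C (fun i => s ((i : ℕ) + 1)) ∧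
        (A + B - (C + C)).PosSemidef) ↔
    (∃ A B C : Matrix (Fin p) (Fin p) ℂ,
        HasEigs (Matrix.fromBlocks A 0 0 B) (fun i => γ ((finSumFinEquiv i : ℕ) + 1)) ∧
        HasEigs C (fun i : Fin p => s ((i : ℕ) + 1)) ∧
        (A + B - (C + C)).PosSemidef) := by
  set e : Equiv.Perm (Fin p ⊕ Fin p) := finSumFinEquiv.trans (oddEvenEquiv p).symm with he
  set g : Fin p ⊕ Fin p → ℝ := fun c => γ ((oddEvenEquiv p c : ℕ) + 1) with hg
  have hge : g ∘ e = fun c => γ ((finSumFinEquiv c : ℕ) + 1) := by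
    ext c
    simp [hg, he]
  have hgl : (fun i : Fin p => γ (2 * (i : ℕ) + 1)) = fun i => g (.inl i) := rfl
  have hgr : (fun i : Fin p => γ (2 * (i : ℕ) + 2)) = fun i => g (.inr i) := rfl
  rw [← hge, hgl, hgr]
  constructor
  · rintro ⟨A, B, C, hA, hB, hC, hpos⟩
    refine ⟨A, B, C, ?_, hC, hpos⟩
    have h := (hA.fromBlocks hB).perm e
    have hs : Sum.elim (fun i => g (.inl i)) (fun i => g (.inr i)) = g := Sum.elim_comp_inl_inr g
    rwa [hs] at h
  · rintro ⟨A, B, C, hAB, hC, hpos⟩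
    obtain ⟨π, hA, hB⟩ := hAB.exists_perm_of_fromBlocks
    obtain ⟨U, rfl⟩ := hasEigs_iff_exists_unitaryGroup.1 hA
    obtain ⟨V, rfl⟩ := hasEigs_iff_exists_unitaryGroup.1 hB
    have hpair : ∀ k, g (.inr k) ≤ g (.inl k) := fun k =>
      hγmono (2 * k + 1) (2 * k + 2) (by omega) (by omega) (by omega)
    have hlt : ∀ i k, i < k → g (.inl k) ≤ g (.inr i) := fun i k hik =>
      hγmono (2 * i + 2) (2 * k + 1) (by omega) (by omega) (by omega)
    obtain ⟨w, hw⟩ := exists_orbitSum_eq_of_weakly_interlacing hpair hlt (π.trans e) (U, V)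
    refine ⟨_, _, C, hasEigs_iff_exists_unitaryGroup.2 ⟨w.1, rfl⟩,
      hasEigs_iff_exists_unitaryGroup.2 ⟨w.2, rfl⟩, hC, ?_⟩
    change (orbitSum _ _ w - (C + C)).PosSemidef
    rw [hw]
    exact hpos
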